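/- Let G be a connected Cohen–Macaulay closed graph with t ≥ 2 maximal cliques. Then for every integer k ≥ 1, the v-number of the k-th power of the binomial edge ideal satisfies v(J_{K_2,G}^k) = ⌈2(t−1)/3⌉ + 2(k−1). In particular, for the path P_n (n ≥ 3), v(J_{K_2,P_n}^k) = ⌈2(n−2)/3⌉ + 2(k−1). -/

import Mathlib

open MvPolynomial

noncomputable def minor (K : Type*) [Field K] (i j k l : ℕ) : MvPolynomial (ℕ × ℕ) K :=
  X (i, k) * X (j, l) - X (i, l) * X (j, k)

noncomputable def genBEI (K : Type*) [Field K] (m : ℕ) (G : SimpleGraph ℕ) :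
    Ideal (MvPolynomial (ℕ × ℕ) K) :=
  Ideal.span {f | ∃ i j k l : ℕ, 1 ≤ i ∧ i < j ∧ j ≤ m ∧ k < l ∧ G.Adj k l ∧ f = minor K i j k l}

def pathGraph (n : ℕ) : SimpleGraph ℕ :=
  SimpleGraph.fromRel (fun u v => 1 ≤ u ∧ v = u + 1 ∧ v ≤ n)

/-- The v-number of a graded ideal `I`: the least `d` such that some homogeneous `f`
of degree `d` has `(I : f)` equal to an associated prime of `I`. -/
noncomputable def vNumber {K : Type*} [Field K] (I : Ideal (MvPolynomial (ℕ × ℕ) K)) : ℕ :=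
  sInf {d : ℕ | ∃ f : MvPolynomial (ℕ × ℕ) K,
    f.IsHomogeneous d ∧ (Submodule.colon I (Ideal.span {f})).IsPrime ∧
    Submodule.colon I (Ideal.span {f}) ∈ associatedPrimes (MvPolynomial (ℕ × ℕ) K)
      (MvPolynomial (ℕ × ℕ) K ⧸ I)}

section Lead

variable {σ K : Type*} [Field K]

/-- `t` is the unique leading exponent of `p` for the weight `θ`, with coefficient one. -/
def LeadMono (θ : σ → ℤ) (p : MvPolynomial σ K) (t : σ →₀ ℕ) : Prop :=
  coeff t p = 1 ∧ ∀ s ∈ p.support, s ≠ t → Finsupp.weight θ s < Finsupp.weight θ t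

lemma LeadMono.le {θ : σ → ℤ} {p : MvPolynomial σ K} {t : σ →₀ ℕ} (h : LeadMono θ p t)
    {s : σ →₀ ℕ} (hs : s ∈ p.support) : Finsupp.weight θ s ≤ Finsupp.weight θ t := by
  by_cases e : s = t
  · rw [e]
  · exact (h.2 s hs e).le

lemma LeadMono.one (θ : σ → ℤ) : LeadMono θ (1 : MvPolynomial σ K) 0 := by
  classical
  refine ⟨by simp, ?_⟩
  intro s hs hne
  exfalso
  rw [mem_support_iff, coeff_one] at hs
  exact hs (if_neg (Ne.symm hne))

lemma LeadMono.mul {θ : σ → ℤ} {p q : MvPolynomial σ K} {t u : σ →₀ ℕ}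
    (hp : LeadMono θ p t) (hq : LeadMono θ q u) : LeadMono θ (p * q) (t + u) := by
  classical
  constructor
  · rw [coeff_mul, Finset.sum_eq_single (t, u)]
    · simp [hp.1, hq.1]
    · rintro ⟨a, c⟩ hac hne
      by_contra h0
      have ha : a ∈ p.support := mem_support_iff.2 (left_ne_zero_of_mul h0)
      have hc : c ∈ q.support := mem_support_iff.2 (right_ne_zero_of_mul h0)
      have hs : a + c = t + u := by simpa using hac
      have hw := congrArg (Finsupp.weight θ) hs
      simp only [map_add] at hw
      have h1 := hp.le ha
      have h2 := hq.le hc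
      by_cases e : a = t
      · subst e
        exact hne (by rw [add_left_cancel hs])
      · have := hp.2 a ha e
        linarith
    · simp
  · intro s hs hne
    obtain ⟨a, ha, c, hc, rfl⟩ := Finset.mem_add.1 (support_mul p q hs)
    have h1 := hp.le ha
    have h2 := hq.le hc
    simp only [map_add]
    by_cases e : a = t
    · subst e
      have : c ≠ u := fun e => hne (by rw [e])
      have := hq.2 c hc this
      linarith
    · have := hp.2 a ha e
      linarith

lemma LeadMono.pow {θ : σ → ℤ} {p : MvPolynomial σ K} {t : σ →₀ ℕ}
    (hp : LeadMono θ p t) (n : ℕ) : LeadMono θ (p ^ n) (n • t) := by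
  induction n with
  | zero => simpa using LeadMono.one θ
  | succ n ih => rw [pow_succ, succ_nsmul]; exact ih.mul hp

lemma LeadMono.aeval {θ : σ → ℤ} {φ : σ → MvPolynomial σ K} {e : σ → (σ →₀ ℕ)}
    (h : ∀ v, LeadMono θ (φ v) (e v)) (m : σ →₀ ℕ) :
    LeadMono θ (MvPolynomial.aeval φ (monomial m (1 : K))) (Finsupp.weight e m) := by
  classical
  induction m using Finsupp.induction_linear with
  | zero => simpa using LeadMono.one θ
  | add a c ha hc =>
    have : (monomial (a + c) (1 : K)) = monomial a 1 * monomial c 1 := by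
      rw [monomial_mul, one_mul]
    rw [this, map_mul, map_add]
    exact ha.mul hc
  | single v n =>
    rw [Finsupp.weight_single, aeval_monomial]
    simpa using (h v).pow n

/-- `m` is an exponent of `f` of maximal weight. -/
def IsTopMono (W : σ → ℕ) (f : MvPolynomial σ K) (m : σ →₀ ℕ) : Prop :=
  m ∈ f.support ∧ ∀ s ∈ f.support, Finsupp.weight W s ≤ Finsupp.weight W m

lemma weight_comp {M : Type*} [AddCommMonoid M] (θ : σ → M) (e : σ → (σ →₀ ℕ)) (m : σ →₀ ℕ) :
    Finsupp.weight θ (Finsupp.weight e m) = Finsupp.weight (fun v => Finsupp.weight θ (e v)) m := by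
  induction m using Finsupp.induction_linear with
  | zero => simp
  | add a c ha hc => simp only [map_add, ha, hc]
  | single v n => simp only [Finsupp.weight_single, map_nsmul]

lemma weight_cast (W : σ → ℕ) (m : σ →₀ ℕ) :
    Finsupp.weight (fun v => (W v : ℤ)) m = ((Finsupp.weight W m : ℕ) : ℤ) := by
  induction m using Finsupp.induction_linear with
  | zero => simp
  | add a c ha hc => simp only [map_add, ha, hc, Nat.cast_add]
  | single v n => simp [Finsupp.weight_single]

lemma coeff_top {θ : σ → ℤ} {W : σ → ℕ} {φ : σ → MvPolynomial σ K} {e : σ → (σ →₀ ℕ)}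
    (h : ∀ v, LeadMono θ (φ v) (e v)) (hW : ∀ v, Finsupp.weight θ (e v) = W v)
    (hinj : Function.Injective (Finsupp.weight (R := ℕ) e))
    {f : MvPolynomial σ K} {m : σ →₀ ℕ} (hm : IsTopMono W f m) :
    coeff (Finsupp.weight e m) (MvPolynomial.aeval φ f) = coeff m f := by
  classical
  have hw : ∀ s : σ →₀ ℕ, Finsupp.weight θ (Finsupp.weight e s) = ((Finsupp.weight W s : ℕ) : ℤ) := by
    intro s
    rw [weight_comp, ← weight_cast]
    simp only [hW]
  have hf : MvPolynomial.aeval φ f =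
      ∑ s ∈ f.support, C (coeff s f) * MvPolynomial.aeval φ (monomial s (1 : K)) := by
    conv_lhs => rw [f.as_sum]
    rw [map_sum]
    refine Finset.sum_congr rfl fun s _ => ?_
    rw [aeval_monomial, aeval_monomial]
    simp
  rw [hf, coeff_sum, Finset.sum_eq_single m]
  · rw [coeff_C_mul, (LeadMono.aeval h m).1, mul_one]
  · intro s hs hne
    rw [coeff_C_mul]
    by_contra h0
    have h1 := mem_support_iff.2 (right_ne_zero_of_mul h0)
    have hne' : Finsupp.weight e m ≠ Finsupp.weight e s := fun E => hne (hinj E).symm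
    have h2 := (LeadMono.aeval h s).2 _ h1 hne'
    rw [hw, hw] at h2
    have h3 := hm.2 s hs
    omega
  · intro h0
    exact absurd hm.1 h0

lemma weight_add_injective (ex : σ → (σ →₀ ℕ)) (hex : ∀ u v, ex v u ≠ 0 → ex u = 0) :
    Function.Injective (Finsupp.weight (R := ℕ) (fun v => Finsupp.single v 1 + ex v)) := by
  classical
  have hE : ∀ m : σ →₀ ℕ, Finsupp.weight (R := ℕ) (fun v => Finsupp.single v 1 + ex v) m =
      m + Finsupp.weight (R := ℕ) ex m := by
    intro m
    induction m using Finsupp.induction_linear with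
    | zero => simp
    | add a c ha hc => simp only [map_add, ha, hc]; abel
    | single v n =>
      simp only [Finsupp.weight_single, smul_add]
      simp
  have hz : ∀ (m : σ →₀ ℕ) (u : σ), ex u ≠ 0 → Finsupp.weight (R := ℕ) ex m u = 0 := by
    intro m u hu
    induction m using Finsupp.induction_linear with
    | zero => simp
    | add a c ha hc => simp [ha, hc]
    | single v n =>
      simp only [Finsupp.weight_single, Finsupp.smul_apply, smul_eq_mul]
      by_cases h : ex v u = 0
      · simp [h]
      · exact absurd (hex u v h) hu
  intro m m' h
  rw [hE, hE] at h
  have h1 : ∀ u, ex u ≠ 0 → m u = m' u := by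
    intro u hu
    have := DFunLike.congr_fun h u
    simpa [hz _ u hu] using this
  have h2 : Finsupp.weight (R := ℕ) ex m = Finsupp.weight (R := ℕ) ex m' := by
    rw [Finsupp.weight_apply, Finsupp.weight_apply,
      Finsupp.sum_of_support_subset m (s := m.support ∪ m'.support) Finset.subset_union_left _
        (by simp),
      Finsupp.sum_of_support_subset m' (s := m.support ∪ m'.support) Finset.subset_union_right _
        (by simp)]
    refine Finset.sum_congr rfl fun u _ => ?_
    by_cases hu : ex u = 0
    · simp [hu]
    · rw [h1 u hu]
  rw [h2] at h
  exact add_right_cancel h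

/-- all monomials of `p` have `ω`-weight at least `k`. -/
def OrdGE (ω : σ → ℕ) (k : ℕ) (p : MvPolynomial σ K) : Prop :=
  ∀ s ∈ p.support, k ≤ Finsupp.weight ω s

lemma OrdGE.add {ω : σ → ℕ} {k : ℕ} {p q : MvPolynomial σ K} (hp : OrdGE ω k p)
    (hq : OrdGE ω k q) : OrdGE ω k (p + q) := by
  classical
  intro s hs
  rcases Finset.mem_union.1 (support_add hs) with h | h
  · exact hp s h
  · exact hq s h

lemma OrdGE.zero {ω : σ → ℕ} {k : ℕ} : OrdGE ω k (0 : MvPolynomial σ K) := by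
  intro s hs
  simp at hs

lemma OrdGE.mul {ω : σ → ℕ} {k l : ℕ} {p q : MvPolynomial σ K} (hp : OrdGE ω k p)
    (hq : OrdGE ω l q) : OrdGE ω (k + l) (p * q) := by
  classical
  intro s hs
  obtain ⟨a, ha, c, hc, rfl⟩ := Finset.mem_add.1 (support_mul p q hs)
  rw [map_add]
  exact add_le_add (hp a ha) (hq c hc)

lemma OrdGE.any {ω : σ → ℕ} (p : MvPolynomial σ K) : OrdGE ω 0 p := fun _ _ => Nat.zero_le _

lemma OrdGE.mul_left {ω : σ → ℕ} {k : ℕ} (p : MvPolynomial σ K) {q : MvPolynomial σ K}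
    (hq : OrdGE ω k q) : OrdGE ω k (p * q) := by
  simpa using (OrdGE.any p).mul hq

/-- The ideal of polynomials whose image under `φ` has order at least `k`. -/
def ordIdeal (ω : σ → ℕ) (φ : σ → MvPolynomial σ K) (k : ℕ) : Ideal (MvPolynomial σ K) where
  carrier := {p | OrdGE ω k (MvPolynomial.aeval φ p)}
  add_mem' := by
    intro a c ha hc
    simpa using OrdGE.add ha hc
  zero_mem' := by simpa using (OrdGE.zero (K := K) (ω := ω) (k := k))
  smul_mem' := by
    intro c x hx
    simpa using OrdGE.mul_left _ hx

lemma pow_le_ordIdeal {ω : σ → ℕ} {φ : σ → MvPolynomial σ K} {I : Ideal (MvPolynomial σ K)}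
    (h : I ≤ ordIdeal ω φ 1) (k : ℕ) : I ^ k ≤ ordIdeal ω φ k := by
  induction k with
  | zero =>
    intro x _
    exact OrdGE.any _
  | succ k ih =>
    rw [pow_succ, Ideal.mul_le]
    intro r hr s hs
    have h1 : OrdGE ω k (MvPolynomial.aeval φ r) := ih hr
    have h2 : OrdGE ω 1 (MvPolynomial.aeval φ s) := h hs
    show OrdGE ω (k + 1) (MvPolynomial.aeval φ (r * s))
    rw [map_mul]
    exact h1.mul h2

/-- killing the variables of positive weight -/
noncomputable def killVar (ω : σ → ℕ) : σ → MvPolynomial σ K :=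
  fun v => if ω v = 0 then X v else 0

lemma ordGE_one_iff_kill (ω : σ → ℕ) (p : MvPolynomial σ K) :
    OrdGE ω 1 p ↔ MvPolynomial.aeval (killVar (K := K) ω) p = 0 := by
  classical
  have hmon : ∀ m : σ →₀ ℕ, MvPolynomial.aeval (killVar (K := K) ω) (monomial m (1 : K)) =
      if Finsupp.weight ω m = 0 then monomial m 1 else 0 := by
    intro m
    induction m using Finsupp.induction_linear with
    | zero => simp
    | add a c ha hc =>
      have : (monomial (a + c) (1 : K)) = monomial a 1 * monomial c 1 := by
        rw [monomial_mul, one_mul]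
      rw [this, map_mul, ha, hc, map_add]
      by_cases h1 : Finsupp.weight ω a = 0 <;> by_cases h2 : Finsupp.weight ω c = 0 <;>
        simp [h1, h2]
    | single v n =>
      rw [Finsupp.weight_single, aeval_monomial]
      by_cases hn : n = 0
      · simp [hn]
      by_cases h : ω v = 0
      · simp [killVar, h, X_pow_eq_monomial]
      · simp [killVar, h, hn]
  have hf : MvPolynomial.aeval (killVar (K := K) ω) p =
      ∑ s ∈ p.support, if Finsupp.weight ω s = 0 then monomial s (coeff s p) else 0 := by
    conv_lhs => rw [p.as_sum]
    rw [map_sum]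
    refine Finset.sum_congr rfl fun s _ => ?_
    have : monomial s (coeff s p) = C (coeff s p) * monomial s 1 := by rw [C_mul_monomial, mul_one]
    rw [this, map_mul, hmon]
    split_ifs <;> simp
  have hc : ∀ s, coeff s (MvPolynomial.aeval (killVar (K := K) ω) p) =
      if Finsupp.weight ω s = 0 then coeff s p else 0 := by
    intro s
    rw [hf, coeff_sum]
    by_cases hs : s ∈ p.support
    · rw [Finset.sum_eq_single s]
      · split_ifs <;> simp
      · intro u _ hu
        split_ifs
        · rw [coeff_monomial, if_neg hu]
        · simp
      · exact fun h => absurd hs h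
    · rw [Finset.sum_eq_zero]
      · simp [notMem_support_iff.1 hs]
      · intro u hu
        have : u ≠ s := fun e => hs (e ▸ hu)
        split_ifs
        · rw [coeff_monomial, if_neg this]
        · simp
  constructor
  · intro h
    ext s
    rw [hc]
    split_ifs with h0
    · by_contra hne
      have := h s (mem_support_iff.2 (by simpa using hne))
      omega
    · simp
  · intro h s hs
    have := hc s
    rw [h] at this
    by_contra h0
    rw [if_pos (by omega)] at this
    exact (mem_support_iff.1 hs) (by simpa using this.symm)

end Lead

section Datum
set_option linter.unusedSimpArgs false

variable {K : Type*} [Field K]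

lemma LeadMono.X {σ : Type*} (θ : σ → ℤ) (v : σ) :
    LeadMono θ (MvPolynomial.X v : MvPolynomial σ K) (Finsupp.single v 1) := by
  classical
  refine ⟨by simp, fun s hs hne => ?_⟩
  rw [support_X, Finset.mem_singleton] at hs
  exact absurd hs hne

lemma LeadMono.add_lower {σ : Type*} {θ : σ → ℤ} {p q : MvPolynomial σ K} {t u : σ →₀ ℕ}
    (hp : LeadMono θ p t) (hq : LeadMono θ q u) (hlt : Finsupp.weight θ u < Finsupp.weight θ t) :
    LeadMono θ (p + q) t := by
  classical
  have hq' : ∀ s ∈ q.support, Finsupp.weight θ s < Finsupp.weight θ t := fun s hs =>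
    (hq.le hs).trans_lt hlt
  refine ⟨?_, ?_⟩
  · rw [coeff_add, hp.1]
    by_cases h : t ∈ q.support
    · exact absurd (hq' t h) (lt_irrefl _)
    · rw [notMem_support_iff.1 h, add_zero]
  · intro s hs hne
    rcases Finset.mem_union.1 (support_add hs) with h | h
    · exact hp.2 s h hne
    · exact hq' s h

open Classical in
/-- the deformation substitution attached to a cover -/
noncomputable def phi (K : Type*) [Field K] (S : Set ℕ) (c : ℕ → ℕ) :
    ℕ × ℕ → MvPolynomial (ℕ × ℕ) K := fun v =>
  if v.2 ∈ S then X v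
  else if v.1 = 1 then
    (if v.2 < c v.2 then X (1, v.2) + X (1, c v.2) * X (2, v.2)
      else if c v.2 < v.2 then X (1, v.2) * X (1, c v.2) else X v)
  else if v.1 = 2 then
    (if v.2 < c v.2 then X (2, v.2) * X (2, c v.2)
      else if c v.2 < v.2 then X (2, v.2) + X (2, c v.2) * X (1, v.2) else X v)
  else X v

open Classical in
/-- the extra exponent of the leading monomial -/
noncomputable def exm (S : Set ℕ) (c : ℕ → ℕ) : ℕ × ℕ → (ℕ × ℕ →₀ ℕ) := fun v =>
  if v.2 ∈ S then 0
  else if v.1 = 1 ∧ c v.2 < v.2 then Finsupp.single (1, c v.2) 1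
  else if v.1 = 2 ∧ v.2 < c v.2 then Finsupp.single (2, c v.2) 1
  else 0

/-- source weight -/
def wtW : ℕ × ℕ → ℕ := fun v => if v.1 = 2 then v.2 else 0

open Classical in
/-- target weight -/
noncomputable def wtT (S : Set ℕ) (c : ℕ → ℕ) : ℕ × ℕ → ℤ := fun v =>
  if v.1 = 2 then (if v.2 ∉ S ∧ v.2 < c v.2 then (v.2 : ℤ) - (c v.2 : ℤ) else (v.2 : ℤ)) else 0

structure IsDatum (S : Set ℕ) (c : ℕ → ℕ) (ω : ℕ × ℕ → ℕ) : Prop where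
  cS : ∀ i, i ∉ S → c i ∉ S
  cc : ∀ i, i ∉ S → c (c i) = c i
  w1 : ∀ i, ω (1, i) ≠ 0 ↔ i ∈ S ∨ i < c i
  w2 : ∀ i, ω (2, i) ≠ 0 ↔ i ∈ S ∨ c i < i
  w3 : ∀ r i, r ≠ 1 → r ≠ 2 → ω (r, i) = 0

variable {S : Set ℕ} {c : ℕ → ℕ} {ω : ℕ × ℕ → ℕ}

lemma IsDatum.w1c (h : IsDatum S c ω) {i : ℕ} (hi : i ∉ S) : ω (1, c i) = 0 := by
  by_contra h0
  rcases (h.w1 _).1 h0 with h1 | h1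
  · exact h.cS i hi h1
  · rw [h.cc i hi] at h1; exact lt_irrefl _ h1

lemma IsDatum.w2c (h : IsDatum S c ω) {i : ℕ} (hi : i ∉ S) : ω (2, c i) = 0 := by
  by_contra h0
  rcases (h.w2 _).1 h0 with h1 | h1
  · exact h.cS i hi h1
  · rw [h.cc i hi] at h1; exact lt_irrefl _ h1

lemma IsDatum.leadMono (h : IsDatum S c ω) (v : ℕ × ℕ) :
    LeadMono (wtT S c) (phi K S c v) (Finsupp.single v 1 + exm S c v) := by
  classical
  obtain ⟨r, i⟩ := v
  by_cases hi : i ∈ S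
  · simp only [phi, exm, hi, if_true, add_zero]
    exact LeadMono.X _ _
  have hcS := h.cS i hi
  have hcc := h.cc i hi
  by_cases h1 : r = 1
  · subst h1
    rcases lt_trichotomy i (c i) with hl | he | hg
    · have : ¬ c i < i := by omega
      simp only [phi, exm, hi, hl, this, if_true, if_false, and_false, add_zero]
      simp only [show ¬ ((1 : ℕ) = 2) by omega, false_and, if_false, add_zero]
      refine LeadMono.add_lower (LeadMono.X _ _) ((LeadMono.X _ _).mul (LeadMono.X _ _)) ?_
      simp only [map_add, Finsupp.weight_single, wtT]
      simp [hi, hl]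
    · have h1 : ¬ c i < i := by omega
      have h2 : ¬ i < c i := by omega
      simp only [phi, exm, hi, h1, h2, if_true, if_false, and_false, add_zero]
      exact LeadMono.X _ _
    · have : ¬ i < c i := by omega
      simp only [phi, exm, hi, hg, this, if_true, if_false, and_true]
      exact (LeadMono.X _ _).mul (LeadMono.X _ _)
  by_cases h2 : r = 2
  · subst h2
    rcases lt_trichotomy i (c i) with hl | he | hg
    · have : ¬ c i < i := by omega
      simp only [phi, exm, hi, hl, this, if_true, if_false, and_true, and_false, h1]
      exact (LeadMono.X _ _).mul (LeadMono.X _ _)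
    · have h1 : ¬ c i < i := by omega
      have h2 : ¬ i < c i := by omega
      simp only [phi, exm, hi, h1, h2, if_true, if_false, and_false, add_zero, 
        show ¬ ((2 : ℕ) = 1) by omega]
      exact LeadMono.X _ _
    · have : ¬ i < c i := by omega
      simp only [phi, exm, hi, hg, this, if_true, if_false, and_true, h1, false_and, and_false,
        add_zero]
      refine LeadMono.add_lower (LeadMono.X _ _) ((LeadMono.X _ _).mul (LeadMono.X _ _)) ?_
      simp only [map_add, Finsupp.weight_single, wtT]
      simp [hi, this, hcc, hg]
  · simp only [phi, exm, hi, h1, h2, if_false, false_and, add_zero]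
    exact LeadMono.X _ _

lemma IsDatum.lead (h : IsDatum S c ω) {k : ℕ} {f : MvPolynomial (ℕ × ℕ) K} {m : ℕ × ℕ →₀ ℕ}
    (hf : OrdGE ω k (aeval (phi K S c) f)) (hm : IsTopMono wtW f m) :
    k ≤ Finsupp.weight ω m := by
  classical
  have hW : ∀ v, Finsupp.weight (wtT S c) (Finsupp.single v 1 + exm S c v) = wtW v := by
    rintro ⟨r, i⟩
    simp only [map_add, Finsupp.weight_single, exm, wtW, wtT]
    by_cases hi : i ∈ S
    · simp [hi]
    have hcc := h.cc i hi
    by_cases h1 : r = 1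
    · subst h1
      by_cases hg : c i < i <;> simp [hi, hg, Finsupp.weight_single, wtT]
    by_cases h2 : r = 2
    · subst h2
      by_cases hg : i < c i <;> simp [hi, hg, hcc, Finsupp.weight_single, wtT]
    · simp [h1, h2]
  have hinj : Function.Injective
      (Finsupp.weight (R := ℕ) (fun v => Finsupp.single v 1 + exm S c v)) := by
    refine weight_add_injective _ ?_
    rintro ⟨r', i'⟩ ⟨r, i⟩ hne
    by_cases hi : i ∈ S
    · simp [exm, hi] at hne
    have hcS := h.cS i hi
    have hcc := h.cc i hi
    simp only [exm, hi, if_false] at hne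
    split_ifs at hne with h1 h2
    · rw [Finsupp.single_apply] at hne
      have : (1, c i) = (r', i') := by by_contra hh; exact hne (if_neg hh)
      obtain ⟨rfl, rfl⟩ := Prod.mk.inj this
      simp [exm, hcc]
    · rw [Finsupp.single_apply] at hne
      have : (2, c i) = (r', i') := by by_contra hh; exact hne (if_neg hh)
      obtain ⟨rfl, rfl⟩ := Prod.mk.inj this
      simp [exm, hcc]
    · simp at hne
  have hc := coeff_top (fun v => h.leadMono (K := K) v) hW hinj hm
  have hs : Finsupp.weight (R := ℕ) (fun v => Finsupp.single v 1 + exm S c v) m ∈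
      (aeval (phi K S c) f).support := by
    rw [mem_support_iff, hc]
    exact mem_support_iff.1 hm.1
  have := hf _ hs
  rw [weight_comp] at this
  have hω : (fun v => Finsupp.weight ω (Finsupp.single v 1 + exm S c v)) = ω := by
    funext v
    obtain ⟨r, i⟩ := v
    by_cases hi : i ∈ S
    · simp [exm, hi, Finsupp.weight_single]
    simp only [map_add, exm, hi, if_false]
    split_ifs
    · simp [Finsupp.weight_single, h.w1c hi]
    · simp [Finsupp.weight_single, h.w2c hi]
    · simp [Finsupp.weight_single]
  rwa [hω] at this

/-- the column factor -/
noncomputable def pfac (K : Type*) [Field K] (c : ℕ → ℕ) (i : ℕ) : MvPolynomial (ℕ × ℕ) K :=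
  if i < c i then X (2, i) else if c i < i then X (1, i) else 1

lemma IsDatum.kill_S (h : IsDatum S c ω) {r i : ℕ} (hr : r = 1 ∨ r = 2) (hi : i ∈ S) :
    aeval (killVar (K := K) ω) (phi K S c (r, i)) = 0 := by
  simp only [phi, hi, if_true, aeval_X, killVar]
  rw [if_neg]
  rcases hr with rfl | rfl
  · exact (h.w1 i).2 (Or.inl hi)
  · exact (h.w2 i).2 (Or.inl hi)

lemma IsDatum.kill_row (h : IsDatum S c ω) {r i : ℕ} (hr : r = 1 ∨ r = 2) (hi : i ∉ S) :
    aeval (killVar (K := K) ω) (phi K S c (r, i)) = X (r, c i) * pfac K c i := by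
  have a1 := h.w1c hi
  have a2 := h.w2c hi
  have b1 := h.w1 i
  have b2 := h.w2 i
  rcases lt_trichotomy i (c i) with hl | he | hg
  · have hg : ¬ c i < i := by omega
    have c1 : ω (1, i) ≠ 0 := b1.2 (Or.inr hl)
    have c2 : ω (2, i) = 0 := by by_contra hh; rcases b2.1 hh with h | h <;> tauto
    rcases hr with rfl | rfl
    · simp [phi, hi, hl, pfac, killVar, a1, c1, c2]
    · simp [phi, hi, hl, pfac, killVar, a2, c2, mul_comm]
  · have hg : ¬ c i < i := by omega
    have hl : ¬ i < c i := by omega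
    have c1 : ω (1, i) = 0 := by by_contra hh; rcases b1.1 hh with h | h <;> tauto
    have c2 : ω (2, i) = 0 := by by_contra hh; rcases b2.1 hh with h | h <;> tauto
    rcases hr with rfl | rfl
    · simp only [phi, hi, hl, hg, pfac, if_true, if_false, mul_one, aeval_X, killVar, c1]
      rw [← he]
    · simp [phi, hi, hl, hg, pfac, killVar, c2]
      rw [← he]
  · have hl : ¬ i < c i := by omega
    have c2 : ω (2, i) ≠ 0 := b2.2 (Or.inr hg)
    have c1 : ω (1, i) = 0 := by by_contra hh; rcases b1.1 hh with h | h <;> tauto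
    rcases hr with rfl | rfl
    · simp [phi, hi, hl, hg, pfac, killVar, a1, c1, mul_comm]
    · simp [phi, hi, hl, hg, pfac, killVar, a2, c1, c2]

lemma IsDatum.kill_other (h : IsDatum S c ω) {r i : ℕ} (h1 : r ≠ 1) (h2 : r ≠ 2) :
    aeval (killVar (K := K) ω) (phi K S c (r, i)) = X (r, i) := by
  simp [phi, h1, h2, killVar, h.w3 r i h1 h2]

end Datum

section Blocks
set_option linter.unusedSimpArgs false
set_option linter.unusedVariables false

variable {K : Type*} [Field K]

structure IsBlk (b : ℕ → ℕ) (t : ℕ) : Prop where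
  h0 : b 0 = 1
  lt : ∀ i, i < t → b i < b (i + 1)

lemma IsBlk.mono {b : ℕ → ℕ} {t : ℕ} (B : IsBlk b t) {i j : ℕ} (hij : i ≤ j) (hj : j ≤ t) :
    b i ≤ b j := by
  induction j with
  | zero => obtain rfl : i = 0 := by omega
            exact le_rfl
  | succ j ih =>
    rcases Nat.lt_or_ge j i with h | h
    · obtain rfl : i = j + 1 := by omega
      exact le_rfl
    · exact (ih h (by omega)).trans (B.lt j (by omega)).le

lemma IsBlk.one_le {b : ℕ → ℕ} {t : ℕ} (B : IsBlk b t) {i : ℕ} (hi : i ≤ t) : 1 ≤ b i :=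
  B.h0 ▸ B.mono (Nat.zero_le i) hi

/-- a cover: one point in each block -/
def IsCov (b : ℕ → ℕ) (t : ℕ) (g : ℕ → ℕ) : Prop := ∀ i, i < t → b i ≤ g i ∧ g i ≤ b (i + 1)

def inX (b : ℕ → ℕ) (t : ℕ) (g : ℕ → ℕ) (j : ℕ) : Prop := ∃ i, i < t ∧ b i ≤ j ∧ j < g i

def inY (b : ℕ → ℕ) (t : ℕ) (g : ℕ → ℕ) (j : ℕ) : Prop := ∃ i, i < t ∧ g i < j ∧ j ≤ b (i + 1)

def inN (b : ℕ → ℕ) (t : ℕ) (g : ℕ → ℕ) (j : ℕ) : Prop := ¬ inX b t g j ∧ ¬ inY b t g j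

def setS (b : ℕ → ℕ) (t : ℕ) (g : ℕ → ℕ) : Set ℕ := {j | inX b t g j ∧ inY b t g j}

/-- the weight attached to a cover -/
def omg (b : ℕ → ℕ) (t : ℕ) (g : ℕ → ℕ) (v : ℕ × ℕ) : ℕ :=
  ∑ i ∈ Finset.range t, if (v.1 = 1 ∧ b i ≤ v.2 ∧ v.2 < g i) ∨
    (v.1 = 2 ∧ g i < v.2 ∧ v.2 ≤ b (i + 1)) then 1 else 0

/-- block weight -/
def bw (b : ℕ → ℕ) (m : ℕ × ℕ →₀ ℕ) (i γ : ℕ) : ℕ :=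
  ∑ j ∈ Finset.Ico (b i) γ, m (1, j) + ∑ j ∈ Finset.Ioc γ (b (i + 1)), m (2, j)

lemma weight_omg (b : ℕ → ℕ) (t : ℕ) (g : ℕ → ℕ) (m : ℕ × ℕ →₀ ℕ) :
    Finsupp.weight (omg b t g) m = ∑ i ∈ Finset.range t, bw b m i (g i) := by
  classical
  induction m using Finsupp.induction_linear with
  | zero => simp [bw]
  | add a c ha hc =>
    rw [map_add, ha, hc, ← Finset.sum_add_distrib]
    refine Finset.sum_congr rfl fun i _ => ?_
    simp only [bw, Finsupp.add_apply, Finset.sum_add_distrib]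
    ring
  | single v n =>
    obtain ⟨r, l⟩ := v
    rw [Finsupp.weight_single, omg, Finset.smul_sum]
    refine Finset.sum_congr rfl fun i _ => ?_
    simp only [bw, Finsupp.single_apply, Prod.mk.injEq]
    by_cases h1 : r = 1
    · subst h1
      simp only [show ¬ ((1 : ℕ) = 2) by omega, false_and, or_false, true_and, if_false,
        Finset.sum_const_zero, add_zero, Finset.sum_ite_eq, Finset.mem_Ico]
      split_ifs <;> simp
    by_cases h2 : r = 2
    · subst h2
      simp only [show ¬ ((2 : ℕ) = 1) by omega, false_and, false_or, true_and, if_false,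
        Finset.sum_const_zero, zero_add, Finset.sum_ite_eq, Finset.mem_Ioc]
      split_ifs <;> simp
    · simp [h1, h2]

lemma omg1 {b : ℕ → ℕ} {t : ℕ} {g : ℕ → ℕ} (i : ℕ) : omg b t g (1, i) ≠ 0 ↔ inX b t g i := by
  unfold omg inX
  rw [Ne, Finset.sum_eq_zero_iff]
  push Not
  simp

lemma omg2 {b : ℕ → ℕ} {t : ℕ} {g : ℕ → ℕ} (i : ℕ) : omg b t g (2, i) ≠ 0 ↔ inY b t g i := by
  unfold omg inY
  rw [Ne, Finset.sum_eq_zero_iff]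
  push Not
  simp

variable {b g : ℕ → ℕ} {t : ℕ}

open Classical in
noncomputable def cen (b : ℕ → ℕ) (t : ℕ) (g : ℕ → ℕ) (i : ℕ) : ℕ :=
  if inY b t g i then Nat.findGreatest (inN b t g) i
  else if h : ∃ p, inN b t g p ∧ i ≤ p then Nat.find h else 0

lemma cen_notY (B : IsBlk b t) (hg : IsCov b t g) {i : ℕ} (h : ¬ inY b t g i) :
    inN b t g (cen b t g i) ∧ i ≤ cen b t g i ∧ ∀ q, i ≤ q → q < cen b t g i → ¬ inN b t g q := by
  classical
  have he : ∃ p, inN b t g p ∧ i ≤ p := by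
    refine ⟨max i (b t) + 1, ⟨?_, ?_⟩, by omega⟩
    · rintro ⟨l, hl, h1, h2⟩
      have := (hg l hl).2
      have := B.mono (show l + 1 ≤ t by omega) le_rfl
      omega
    · rintro ⟨l, hl, h1, h2⟩
      have := B.mono (show l + 1 ≤ t by omega) le_rfl
      omega
  have hc : cen b t g i = Nat.find he := by simp only [cen, h, if_false, dif_pos he]
  rw [hc]
  refine ⟨(Nat.find_spec he).1, (Nat.find_spec he).2, fun q h1 h2 h3 => ?_⟩
  exact Nat.find_min he h2 ⟨h3, h1⟩

lemma cen_Y (B : IsBlk b t) (hg : IsCov b t g) {i : ℕ} (h : inY b t g i) :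
    inN b t g (cen b t g i) ∧ cen b t g i ≤ i ∧ ∀ q, cen b t g i < q → q ≤ i → ¬ inN b t g q := by
  classical
  have h0 : inN b t g 0 := by
    refine ⟨?_, ?_⟩
    · rintro ⟨l, hl, h1, h2⟩
      have := B.one_le hl.le
      omega
    · rintro ⟨l, hl, h1, h2⟩
      omega
  have hc : cen b t g i = Nat.findGreatest (inN b t g) i := by simp only [cen, h, if_true]
  rw [hc]
  refine ⟨Nat.findGreatest_spec (Nat.zero_le i) h0, Nat.findGreatest_le i, fun q h1 h2 => ?_⟩
  exact Nat.findGreatest_is_greatest h1 h2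

lemma cen_N (B : IsBlk b t) (hg : IsCov b t g) {i : ℕ} (h : inN b t g i) : cen b t g i = i := by
  obtain ⟨h1, h2, h3⟩ := cen_notY B hg h.2
  rcases h2.eq_or_lt with h4 | h4
  · exact h4.symm
  · exact absurd h (h3 i le_rfl h4)

lemma isDatum (B : IsBlk b t) (hg : IsCov b t g) :
    IsDatum (setS b t g) (cen b t g) (omg b t g) where
  cS := by
    intro i hi hc
    by_cases h : inY b t g i
    · exact (cen_Y B hg h).1.1 hc.1
    · exact (cen_notY B hg h).1.1 hc.1
  cc := by
    intro i hi
    by_cases h : inY b t g i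
    · exact cen_N B hg (cen_Y B hg h).1
    · exact cen_N B hg (cen_notY B hg h).1
  w1 := by
    intro i
    rw [omg1]
    constructor
    · intro hx
      by_cases h : inY b t g i
      · exact Or.inl ⟨hx, h⟩
      · obtain ⟨h1, h2, h3⟩ := cen_notY B hg h
        rcases h2.eq_or_lt with h4 | h4
        · rw [← h4] at h1
          exact absurd hx h1.1
        · exact Or.inr h4
    · rintro (h | h)
      · exact h.1
      · by_contra hx
        by_cases hy : inY b t g i
        · have := (cen_Y B hg hy).2.1
          omega
        · have := cen_N B hg ⟨hx, hy⟩
          omega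
  w2 := by
    intro i
    rw [omg2]
    constructor
    · intro hy
      obtain ⟨h1, h2, h3⟩ := cen_Y B hg hy
      rcases h2.eq_or_lt with h4 | h4
      · rw [h4] at h1
        exact absurd hy h1.2
      · exact Or.inr h4
    · rintro (h | h)
      · exact h.2
      · by_contra hy
        have := (cen_notY B hg hy).2.1
        omega
  w3 := by
    intro r i h1 h2
    unfold omg
    rw [Finset.sum_eq_zero_iff]
    intro l _
    simp [h1, h2]

/-- inX for points of block `k` other than the right end -/
lemma inX_iff (B : IsBlk b t) (hg : IsCov b t g) {k j : ℕ} (hk : k < t) (h1 : b k ≤ j)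
    (h2 : j < b (k + 1)) : inX b t g j ↔ j < g k := by
  constructor
  · rintro ⟨l, hl, h3, h4⟩
    rcases lt_trichotomy l k with h | h | h
    · have := (hg l hl).2
      have := B.mono (show l + 1 ≤ k by omega) hk.le
      omega
    · rwa [h] at h4
    · have := B.mono (show k + 1 ≤ l by omega) hl.le
      omega
  · intro h
    exact ⟨k, hk, h1, h⟩

lemma inY_iff (B : IsBlk b t) (hg : IsCov b t g) {k j : ℕ} (hk : k < t) (h1 : b k < j)
    (h2 : j ≤ b (k + 1)) : inY b t g j ↔ g k < j := by
  constructor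
  · rintro ⟨l, hl, h3, h4⟩
    rcases lt_trichotomy l k with h | h | h
    · have := B.mono (show l + 1 ≤ k by omega) hk.le
      omega
    · rwa [h] at h3
    · have := B.mono (show k + 1 ≤ l by omega) hl.le
      have := (hg l hl).1
      omega
  · intro h
    exact ⟨k, hk, h, h2⟩

lemma cen_eq (B : IsBlk b t) (hg : IsCov b t g) {k i j : ℕ} (hk : k < t) (hij : i < j)
    (hi : b k ≤ i) (hj : j ≤ b (k + 1)) (hiS : i ∉ setS b t g) (hjS : j ∉ setS b t g) :
    cen b t g i = cen b t g j := by
  have hXi := inX_iff B hg hk hi (by omega)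
  have hYj := inY_iff B hg hk (by omega) hj
  rcases Nat.lt_or_ge (g k) j with hgj | hgj
  · have yj := hYj.2 hgj
    obtain ⟨p1, p2, p3⟩ := cen_Y B hg yj
    rcases Nat.lt_or_ge i (g k) with hgi | hgi
    · have xi := hXi.2 hgi
      have yi : ¬ inY b t g i := fun h => hiS ⟨xi, h⟩
      obtain ⟨q1, q2, q3⟩ := cen_notY B hg yi
      have hN : inN b t g (g k) := by
        refine ⟨?_, ?_⟩
        · rw [inX_iff B hg hk (by omega) (by omega)]; omega
        · rw [inY_iff B hg hk (by omega) (by omega)]; omega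
      have e1 : cen b t g i = g k := by
        rcases lt_trichotomy (cen b t g i) (g k) with h | h | h
        · refine absurd q1 (fun h' => h'.1 ((inX_iff B hg hk (by omega) (by omega)).2 h))
        · exact h
        · exact absurd hN (q3 _ hgi.le h)
      have e2 : cen b t g j = g k := by
        rcases lt_trichotomy (cen b t g j) (g k) with h | h | h
        · exact absurd hN (p3 _ h hgj.le)
        · exact h
        · refine absurd p1 (fun h' => h'.2 ((inY_iff B hg hk (by omega) (by omega)).2 h))
      rw [e1, e2]
    · have hle : cen b t g j ≤ i := by
        by_contra hh
        push Not at hh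
        exact p1.2 ((inY_iff B hg hk (by omega) (by omega)).2 (by omega))
      by_cases yi : inY b t g i
      · obtain ⟨q1, q2, q3⟩ := cen_Y B hg yi
        rcases lt_trichotomy (cen b t g i) (cen b t g j) with h | h | h
        · exact absurd p1 (q3 _ h hle)
        · exact h
        · exact absurd q1 (p3 _ h (by omega))
      · have hN : inN b t g i := ⟨by rw [hXi]; omega, yi⟩
        rw [cen_N B hg hN]
        rcases hle.eq_or_lt with h | h
        · exact h.symm
        · exact absurd hN (p3 _ h (by omega))
  · have yj : ¬ inY b t g j := by rw [hYj]; omega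
    have xi := hXi.2 (by omega)
    have yi : ¬ inY b t g i := fun h => hiS ⟨xi, h⟩
    obtain ⟨p1, p2, p3⟩ := cen_notY B hg yj
    obtain ⟨q1, q2, q3⟩ := cen_notY B hg yi
    have hle : j ≤ cen b t g i := by
      by_contra hh
      push Not at hh
      exact q1.1 ((inX_iff B hg hk (by omega) (by omega)).2 (by omega))
    rcases lt_trichotomy (cen b t g i) (cen b t g j) with h | h | h
    · exact absurd q1 (p3 _ hle h)
    · exact h
    · exact absurd p1 (q3 _ (by omega) h)

/-- adjacency in the block graph, oriented -/
def bAdj (b : ℕ → ℕ) (t u v : ℕ) : Prop := u < v ∧ ∃ i, i < t ∧ b i ≤ u ∧ v ≤ b (i + 1)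

noncomputable def JB (K : Type*) [Field K] (b : ℕ → ℕ) (t : ℕ) : Ideal (MvPolynomial (ℕ × ℕ) K) :=
  Ideal.span {f | ∃ u v, bAdj b t u v ∧ f = minor K 1 2 u v}

lemma minor_mem_JB {u v : ℕ} (h : bAdj b t u v) : minor K 1 2 u v ∈ JB K b t :=
  Ideal.subset_span ⟨u, v, h, rfl⟩

lemma kill_minor_same (B : IsBlk b t) (hg : IsCov b t g) {u v : ℕ}
    (h : u ∉ setS b t g → v ∉ setS b t g → cen b t g u = cen b t g v) :
    aeval (killVar (K := K) (omg b t g))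
      (aeval (phi K (setS b t g) (cen b t g)) (minor K 1 2 u v)) = 0 := by
  have D := isDatum B hg
  simp only [minor, map_sub, map_mul, aeval_X]
  by_cases hu : u ∈ setS b t g
  · rw [D.kill_S (Or.inl rfl) hu, D.kill_S (Or.inr rfl) hu]; ring
  by_cases hv : v ∈ setS b t g
  · rw [D.kill_S (Or.inl rfl) hv, D.kill_S (Or.inr rfl) hv]; ring
  rw [D.kill_row (Or.inl rfl) hu, D.kill_row (Or.inr rfl) hu, D.kill_row (Or.inl rfl) hv,
    D.kill_row (Or.inr rfl) hv, h hu hv]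
  ring

lemma JB_le_ordIdeal (B : IsBlk b t) (hg : IsCov b t g) :
    JB K b t ≤ ordIdeal (omg b t g) (phi K (setS b t g) (cen b t g)) 1 := by
  refine Ideal.span_le.2 ?_
  rintro f ⟨u, v, ⟨huv, i, hi, h1, h2⟩, rfl⟩
  refine (ordGE_one_iff_kill _ _).2 (kill_minor_same B hg fun hu hv => ?_)
  exact cen_eq B hg hi huv h1 h2 hu hv

lemma lead_JB (B : IsBlk b t) (hg : IsCov b t g) {k : ℕ} {f : MvPolynomial (ℕ × ℕ) K}
    {m : ℕ × ℕ →₀ ℕ} (hf : f ∈ JB K b t ^ k) (hm : IsTopMono wtW f m) :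
    k ≤ Finsupp.weight (omg b t g) m :=
  (isDatum B hg).lead (pow_le_ordIdeal (JB_le_ordIdeal B hg) k hf) hm

end Blocks

section Red
set_option linter.unusedSimpArgs false
set_option linter.unusedVariables false

variable {K : Type*} [Field K] {b g : ℕ → ℕ} {t : ℕ}

lemma omg_one (B : IsBlk b t) (hg : IsCov b t g) {k j : ℕ} (hk : k < t) (h1 : b k ≤ j)
    (h2 : j < b (k + 1)) : omg b t g (1, j) = if j < g k then 1 else 0 := by
  unfold omg
  rw [Finset.sum_eq_single k]
  · simp [h1]
  · intro l hl hne
    rw [Finset.mem_range] at hl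
    rw [if_neg]
    rintro (⟨-, h3, h4⟩ | ⟨h, -⟩)
    · rcases lt_or_gt_of_ne hne with h | h
      · have := (hg l hl).2
        have := B.mono (show l + 1 ≤ k by omega) hk.le
        simp only at h3 h4
        omega
      · have := B.mono (show k + 1 ≤ l by omega) hl.le
        simp only at h3 h4
        omega
    · simp at h
  · intro h
    simp at h
    omega

lemma omg_two (B : IsBlk b t) (hg : IsCov b t g) {k j : ℕ} (hk : k < t) (h1 : b k < j)
    (h2 : j ≤ b (k + 1)) : omg b t g (2, j) = if g k < j then 1 else 0 := by
  unfold omg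
  rw [Finset.sum_eq_single k]
  · simp [h2]
  · intro l hl hne
    rw [Finset.mem_range] at hl
    rw [if_neg]
    rintro (⟨h, -⟩ | ⟨-, h3, h4⟩)
    · simp at h
    · rcases lt_or_gt_of_ne hne with h | h
      · have := B.mono (show l + 1 ≤ k by omega) hk.le
        simp only at h3 h4
        omega
      · have := B.mono (show k + 1 ≤ l by omega) hl.le
        have := (hg l hl).1
        simp only at h3 h4
        omega
  · intro h
    simp at h
    omega

/-- exponent of the leading monomial of a minor -/
noncomputable def edg (u v : ℕ) : ℕ × ℕ →₀ ℕ := Finsupp.single (1, u) 1 + Finsupp.single (2, v) 1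

noncomputable def wtZ : ℕ × ℕ → ℤ := fun v => (wtW v : ℤ)

lemma weight_wtZ (m : ℕ × ℕ →₀ ℕ) : Finsupp.weight wtZ m = ((Finsupp.weight wtW m : ℕ) : ℤ) :=
  weight_cast wtW m

lemma minor_lead {u v : ℕ} (h : u < v) : LeadMono wtZ (minor K 1 2 u v) (edg u v) := by
  classical
  have h1 : LeadMono wtZ (X (1, u) * X (2, v) : MvPolynomial (ℕ × ℕ) K) (edg u v) :=
    (LeadMono.X _ _).mul (LeadMono.X _ _)
  have h2 : LeadMono wtZ (X (1, v) * X (2, u) : MvPolynomial (ℕ × ℕ) K) (edg v u) :=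
    (LeadMono.X _ _).mul (LeadMono.X _ _)
  have hW : ∀ u v, Finsupp.weight wtZ (edg u v) = (v : ℤ) := by
    intro u v
    simp [edg, Finsupp.weight_single, wtZ, wtW]
  have hne : edg u v ∉ (X (1, v) * X (2, u) : MvPolynomial (ℕ × ℕ) K).support := by
    intro hh
    have := h2.le hh
    rw [hW, hW] at this
    omega
  refine ⟨?_, ?_⟩
  · rw [minor, coeff_sub, h1.1, notMem_support_iff.1 hne, sub_zero]
  · intro s hs hs'
    rw [minor] at hs
    rcases Finset.mem_union.1 (support_sub _ _ _ hs) with h3 | h3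
    · exact h1.2 s h3 hs'
    · refine (h2.le h3).trans_lt ?_
      rw [hW, hW]
      omega

lemma minor_homog (i j k l : ℕ) : (minor K i j k l).IsHomogeneous 2 := by
  unfold minor
  exact ((isHomogeneous_X K _).mul (isHomogeneous_X K _)).sub
    ((isHomogeneous_X K _).mul (isHomogeneous_X K _))

lemma exists_edge {m : ℕ × ℕ →₀ ℕ} (h : ∀ g, IsCov b t g → 1 ≤ Finsupp.weight (omg b t g) m)
    (B : IsBlk b t) : ∃ d u i, i < t ∧ b i ≤ u ∧ u + d ≤ b (i + 1) ∧ 0 < d ∧ m (1, u) ≠ 0 ∧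
      m (2, u + d) ≠ 0 := by
  classical
  by_contra hno
  push Not at hno
  have key : ∀ i, ∃ γ, i < t → b i ≤ γ ∧ γ ≤ b (i + 1) ∧ bw b m i γ = 0 := by
    intro i
    by_cases hi : i < t
    swap
    · exact ⟨0, fun h => absurd h hi⟩
    by_cases hex : ∃ u, b i ≤ u ∧ u ≤ b (i + 1) ∧ m (1, u) ≠ 0
    · have hs := Nat.find_spec hex
      have hmin := fun q (hq : q < Nat.find hex) => Nat.find_min hex hq
      generalize Nat.find hex = u at hs hmin
      refine ⟨u, fun _ => ⟨hs.1, hs.2.1, ?_⟩⟩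
      unfold bw
      rw [add_comm]
      refine Nat.add_eq_zero_iff.2 ⟨Finset.sum_eq_zero ?_, Finset.sum_eq_zero ?_⟩
      · intro j hj
        rw [Finset.mem_Ioc] at hj
        have := hno (j - u) u i hi hs.1 (by omega) (by omega) hs.2.2
        rwa [show u + (j - u) = j by omega] at this
      · intro j hj
        rw [Finset.mem_Ico] at hj
        by_contra hh
        exact hmin j hj.2 ⟨hj.1, by omega, hh⟩
    · push Not at hex
      refine ⟨b (i + 1), fun _ => ⟨(B.lt i hi).le, le_rfl, ?_⟩⟩
      unfold bw
      rw [Finset.sum_eq_zero]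
      · simp
      · intro j hj
        rw [Finset.mem_Ico] at hj
        exact hex j hj.1 (by omega)
  choose γ hγ using key
  have := h γ (fun i hi => ⟨(hγ i hi).1, (hγ i hi).2.1⟩)
  rw [weight_omg, Finset.sum_eq_zero] at this
  · omega
  · intro i hi
    exact (hγ i (Finset.mem_range.1 hi)).2.2

lemma weight_update (g : ℕ → ℕ) {i γ : ℕ} (hi : i < t) (m : ℕ × ℕ →₀ ℕ) :
    Finsupp.weight (omg b t (Function.update g i γ)) m + bw b m i (g i) =
      Finsupp.weight (omg b t g) m + bw b m i γ := by
  classical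
  rw [weight_omg, weight_omg, ← Finset.add_sum_erase _ _ (Finset.mem_range.2 hi),
    ← Finset.add_sum_erase (Finset.range t) (fun l => bw b m l (g l)) (Finset.mem_range.2 hi)]
  have : ∑ x ∈ (Finset.range t).erase i, bw b m x (Function.update g i γ x) =
      ∑ x ∈ (Finset.range t).erase i, bw b m x (g x) := by
    refine Finset.sum_congr rfl fun x hx => ?_
    rw [Function.update_of_ne (Finset.ne_of_mem_erase hx)]
  rw [this]
  simp
  ring

lemma IsCov.update (hg : IsCov b t g) {i γ : ℕ} (h1 : b i ≤ γ) (h2 : γ ≤ b (i + 1)) :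
    IsCov b t (Function.update g i γ) := by
  intro l hl
  by_cases h : l = i
  · subst h; simp [h1, h2]
  · rw [Function.update_of_ne h]; exact hg l hl

lemma matching (B : IsBlk b t) (k : ℕ) : ∀ m : ℕ × ℕ →₀ ℕ,
    (∀ g, IsCov b t g → k ≤ Finsupp.weight (omg b t g) m) →
    ∃ p ∈ JB K b t ^ k, LeadMono wtZ p m ∧ p.IsHomogeneous m.degree := by
  classical
  induction k with
  | zero =>
    intro m _
    refine ⟨monomial m 1, by simp, ⟨by simp, ?_⟩, isHomogeneous_monomial _ rfl⟩
    intro s hs hne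
    have := support_monomial_subset hs
    simp at this
    exact absurd this hne
  | succ k ih =>
    intro m h
    have hex := exists_edge (m := m) (fun g hg => (by omega : 1 ≤ k + 1).trans (h g hg)) B
    obtain ⟨u, i, hi, h1, h2, hd, hm1, hm2⟩ := Nat.find_spec hex
    have hmin := fun q (hq : q < Nat.find hex) => Nat.find_min hex hq
    generalize Nat.find hex = d at *
    obtain ⟨m', rfl⟩ : ∃ m', m = m' + edg u (u + d) := by
      refine ⟨m - edg u (u + d), ?_⟩
      rw [tsub_add_cancel_of_le]
      intro v
      simp only [edg, Finsupp.add_apply, Finsupp.single_apply]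
      by_cases e1 : (1, u) = v
      · subst e1
        simp
        omega
      by_cases e2 : (2, u + d) = v
      · subst e2
        simp
        omega
      simp [e1, e2]
    have hk : ∀ g, IsCov b t g → k ≤ Finsupp.weight (omg b t g) m' := by
      intro g hg
      have hE : Finsupp.weight (omg b t g) (m' + edg u (u + d)) = Finsupp.weight (omg b t g) m' +
          ((if u < g i then 1 else 0) + (if g i < u + d then 1 else 0)) := by
        rw [map_add, edg, map_add, Finsupp.weight_single, Finsupp.weight_single,
          omg_one B hg hi h1 (by omega), omg_two B hg hi (by omega) h2]
        simp
      have h0 := h g hg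
      by_cases hc : u < g i ∧ g i < u + d
      · have hT := h _ (hg.update (i := i) h1 (by omega))
        have hU := weight_update (b := b) g (γ := u) hi (m' + edg u (u + d))
        have hlt : bw b (m' + edg u (u + d)) i u + 1 ≤ bw b (m' + edg u (u + d)) i (g i) := by
          unfold bw
          have e1 : ∑ j ∈ Finset.Ioc u (b (i + 1)), (m' + edg u (u + d)) (2, j) =
              ∑ j ∈ Finset.Ioc (g i) (b (i + 1)), (m' + edg u (u + d)) (2, j) := by
            symm
            refine Finset.sum_subset (Finset.Ioc_subset_Ioc_left hc.1.le) ?_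
            intro j hj hj'
            rw [Finset.mem_Ioc] at hj hj'
            by_contra hne
            refine hmin (j - u) (by omega) ⟨u, i, hi, h1, by omega, by omega, hm1, ?_⟩
            rwa [show u + (j - u) = j by omega]
          have e2 : ∑ j ∈ Finset.Ico (b i) (u + 1), (m' + edg u (u + d)) (1, j) ≤
              ∑ j ∈ Finset.Ico (b i) (g i), (m' + edg u (u + d)) (1, j) :=
            Finset.sum_le_sum_of_subset (Finset.Ico_subset_Ico_right (by omega))
          rw [Finset.sum_Ico_succ_top h1] at e2
          omega
        simp only [hc.1, hc.2, if_true] at hE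
        omega
      · by_cases hc1 : u < g i
        · have hc2 : ¬ g i < u + d := fun h => hc ⟨hc1, h⟩
          simp only [hc1, hc2, if_true, if_false] at hE
          omega
        · simp only [hc1, if_false] at hE
          split_ifs at hE <;> omega
    obtain ⟨p, hp, hL, hH⟩ := ih m' hk
    refine ⟨p * minor K 1 2 u (u + d), ?_, hL.mul (minor_lead (by omega)), ?_⟩
    · rw [pow_succ]
      exact Ideal.mul_mem_mul hp (minor_mem_JB ⟨by omega, i, hi, h1, h2⟩)
    · have := hH.mul (minor_homog (K := K) 1 2 u (u + d))
      convert this using 1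
      simp [edg, Finsupp.degree_single]

lemma reduce (B : IsBlk b t) (k : ℕ) (N : ℕ) : ∀ f : MvPolynomial (ℕ × ℕ) K,
    (∀ s ∈ f.support, Finsupp.weight wtW s < N) → f ∉ JB K b t ^ k →
    ∃ f' m, f - f' ∈ JB K b t ^ k ∧ IsTopMono wtW f' m ∧
      (∃ g, IsCov b t g ∧ Finsupp.weight (omg b t g) m < k) ∧
      ∀ d, f.IsHomogeneous d → f'.IsHomogeneous d := by
  classical
  induction N with
  | zero =>
    intro f hf hn
    exfalso
    apply hn
    have : f = 0 := by
      rw [← support_eq_empty, Finset.eq_empty_iff_forall_notMem]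
      intro s hs
      exact absurd (hf s hs) (by omega)
    rw [this]
    exact Ideal.zero_mem _
  | succ N ih =>
    intro f hf hn
    by_cases hbad : ∃ m ∈ f.support, Finsupp.weight wtW m = N ∧
        ∃ g, IsCov b t g ∧ Finsupp.weight (omg b t g) m < k
    · obtain ⟨m, hm, hN, hg⟩ := hbad
      refine ⟨f, m, by simp, ⟨hm, fun s hs => ?_⟩, hg, fun d h => h⟩
      have := hf s hs
      omega
    push Not at hbad
    have hp : ∀ m : ℕ × ℕ →₀ ℕ, ∃ p : MvPolynomial (ℕ × ℕ) K,
        m ∈ f.support → Finsupp.weight wtW m = N →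
        p ∈ JB K b t ^ k ∧ LeadMono wtZ p m ∧ p.IsHomogeneous m.degree := by
      intro m
      by_cases hm : m ∈ f.support ∧ Finsupp.weight wtW m = N
      · obtain ⟨p, h1, h2, h3⟩ := matching (K := K) B k m (hbad m hm.1 hm.2)
        exact ⟨p, fun _ _ => ⟨h1, h2, h3⟩⟩
      · exact ⟨0, fun h1 h2 => absurd ⟨h1, h2⟩ hm⟩
    choose p hp using hp
    set T := f.support.filter (fun m => Finsupp.weight wtW m = N) with hT
    have hpT : ∀ m ∈ T, p m ∈ JB K b t ^ k ∧ LeadMono wtZ (p m) m ∧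
        (p m).IsHomogeneous m.degree := by
      intro m hm
      rw [hT, Finset.mem_filter] at hm
      exact hp m hm.1 hm.2
    set q := ∑ m ∈ T, C (coeff m f) * p m with hq
    have hqJ : q ∈ JB K b t ^ k :=
      Ideal.sum_mem _ fun m hm => Ideal.mul_mem_left _ _ (hpT m hm).1
    have hTN : ∀ m ∈ T, Finsupp.weight wtW m = N := fun m hm => (Finset.mem_filter.1 hm).2
    have hlow : ∀ s ∈ (f - q).support, Finsupp.weight wtW s < N := by
      intro s hs
      have hle : Finsupp.weight wtW s ≤ N := by
        rcases Finset.mem_union.1 (support_sub _ _ _ hs) with h | h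
        · have := hf s h; omega
        · have := support_sum h
          rw [Finset.mem_biUnion] at this
          obtain ⟨m, hm, hsm⟩ := this
          have h1 : s ∈ (p m).support := by
            rw [mem_support_iff, coeff_C_mul] at hsm
            exact mem_support_iff.2 (right_ne_zero_of_mul hsm)
          have := (hpT m hm).2.1.le h1
          rw [weight_wtZ, weight_wtZ, hTN m hm] at this
          omega
      refine lt_of_le_of_ne hle fun hE => ?_
      rw [mem_support_iff, coeff_sub] at hs
      apply hs
      rw [hq, coeff_sum]
      have hz : ∀ m ∈ T, m ≠ s → coeff s (C (coeff m f) * p m) = 0 := by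
        intro m hm hne
        rw [coeff_C_mul]
        by_contra h0
        have h1 := mem_support_iff.2 (right_ne_zero_of_mul h0)
        have := (hpT m hm).2.1.2 s h1 hne.symm
        rw [weight_wtZ, weight_wtZ, hTN m hm, hE] at this
        omega
      by_cases hsT : s ∈ T
      · rw [Finset.sum_eq_single s (fun m hm hne => hz m hm hne) (fun h => absurd hsT h),
          coeff_C_mul, (hpT s hsT).2.1.1, mul_one, sub_self]
      · rw [Finset.sum_eq_zero fun m hm => hz m hm (fun e => hsT (e ▸ hm)), sub_zero]
        by_contra h0
        exact hsT (Finset.mem_filter.2 ⟨mem_support_iff.2 h0, hE⟩)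
    have hn' : f - q ∉ JB K b t ^ k := by
      intro h
      apply hn
      have := Ideal.add_mem _ h hqJ
      simpa using this
    obtain ⟨f', m, h1, h2, h3, h4⟩ := ih _ hlow hn'
    refine ⟨f', m, ?_, h2, h3, ?_⟩
    · have := Ideal.add_mem _ h1 hqJ
      have e : f - f' = f - q - f' + q := by ring
      rwa [e]
    · intro d hd
      refine h4 d (hd.sub ?_)
      refine IsHomogeneous.sum _ _ _ fun m hm => ?_
      have h5 : m.degree = d := by
        have := hd (mem_support_iff.1 (Finset.mem_filter.1 hm).1)
        rwa [Finsupp.degree_eq_weight_one]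
      have := (isHomogeneous_C (ℕ × ℕ) (coeff m f)).mul (hpT m hm).2.2
      rwa [zero_add, h5] at this

lemma red (B : IsBlk b t) {k : ℕ} {f : MvPolynomial (ℕ × ℕ) K} (hf : f ∉ JB K b t ^ k) :
    ∃ f' m, f - f' ∈ JB K b t ^ k ∧ IsTopMono wtW f' m ∧
      (∃ g, IsCov b t g ∧ Finsupp.weight (omg b t g) m < k) ∧
      ∀ d, f.IsHomogeneous d → f'.IsHomogeneous d := by
  refine reduce B k (f.support.sup (fun s => Finsupp.weight wtW s) + 1) f ?_ hf
  intro s hs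
  exact Nat.lt_succ_of_le (Finset.le_sup (f := fun s => Finsupp.weight wtW s) hs)

/-- membership test for the ideal itself -/
lemma mem_JB_of_kill (B : IsBlk b t) {f : MvPolynomial (ℕ × ℕ) K}
    (h : ∀ g, IsCov b t g → aeval (killVar (K := K) (omg b t g))
      (aeval (phi K (setS b t g) (cen b t g)) f) = 0) : f ∈ JB K b t := by
  by_contra hf
  rw [← pow_one (JB K b t)] at hf
  obtain ⟨f', m, h1, h2, ⟨g, hg, h3⟩, -⟩ := red B hf
  rw [pow_one] at h1
  have h4 := JB_le_ordIdeal B hg h1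
  have h5 : f ∈ ordIdeal (omg b t g) (phi K (setS b t g) (cen b t g)) 1 :=
    (ordGE_one_iff_kill _ _).2 (h g hg)
  have h6 : f' ∈ ordIdeal (omg b t g) (phi K (setS b t g) (cen b t g)) 1 := by
    have := Ideal.sub_mem _ h5 h4
    simpa using this
  have := (isDatum B hg).lead h6 h2
  omega

end Red

section Lower
set_option linter.unusedSimpArgs false
set_option linter.unusedVariables false

variable {K : Type*} [Field K] {b g : ℕ → ℕ} {t : ℕ}

lemma top_mul {a f : MvPolynomial (ℕ × ℕ) K} {e m : ℕ × ℕ →₀ ℕ} (ha : LeadMono wtZ a e)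
    (hf : IsTopMono wtW f m) : IsTopMono wtW (a * f) (e + m) := by
  classical
  have hle : ∀ s ∈ a.support, Finsupp.weight wtW s ≤ Finsupp.weight wtW e := by
    intro s hs
    have := ha.le hs
    rw [weight_wtZ, weight_wtZ] at this
    omega
  constructor
  · rw [mem_support_iff, coeff_mul, Finset.sum_eq_single (e, m)]
    · simp only [ha.1, one_mul]
      exact mem_support_iff.1 hf.1
    · rintro ⟨s, s'⟩ hss hne
      by_contra h0
      have hs : s ∈ a.support := mem_support_iff.2 (left_ne_zero_of_mul h0)
      have hs' : s' ∈ f.support := mem_support_iff.2 (right_ne_zero_of_mul h0)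
      have hsum : s + s' = e + m := by simpa using hss
      have hw := congrArg (Finsupp.weight wtW) hsum
      simp only [map_add] at hw
      have h1 := hf.2 s' hs'
      by_cases hE : s = e
      · subst hE
        exact hne (by rw [add_left_cancel hsum])
      · have := ha.2 s hs hE
        rw [weight_wtZ, weight_wtZ] at this
        omega
    · simp
  · intro s hs
    obtain ⟨x, hx, y, hy, rfl⟩ := Finset.mem_add.1 (support_mul _ _ hs)
    rw [map_add, map_add]
    exact add_le_add (hle x hx) (hf.2 y hy)

lemma charging (dL dR : ℕ → ℕ) (t : ℕ)
    (h : ∀ j, j + 1 < t → 1 ≤ dL j ∨ 1 ≤ dR (j + 1) ∨ (1 ≤ dR j ∧ 1 ≤ dL (j + 1))) :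
    2 * (t - 1) ≤ 3 * ∑ i ∈ Finset.range t, (dL i + dR i) := by
  have he : ∀ j, ∃ e, j + 1 < t → e ≤ 2 ∧ (e = 2 → 1 ≤ dL j) ∧
      (e = 1 → 1 ≤ dR j ∧ 1 ≤ dL (j + 1)) ∧ (e = 0 → 1 ≤ dR (j + 1)) := by
    intro j
    by_cases hj : j + 1 < t
    · rcases h j hj with h | h | h
      · exact ⟨2, fun _ => by simp [h]⟩
      · exact ⟨0, fun _ => by simp [h]⟩
      · exact ⟨1, fun _ => by simp [h]⟩
    · exact ⟨0, fun h => absurd h hj⟩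
  choose e he using he
  have hc : ∀ T, T + 1 < t → 2 * T + e T ≤ 3 * ∑ i ∈ Finset.range (T + 1), (dL i + dR i) := by
    intro T
    induction T with
    | zero =>
      intro h0
      have := he 0 h0
      simp
      omega
    | succ T ih =>
      intro hT
      have h1 := ih (by omega)
      have h2 := he T (by omega)
      have h3 := he (T + 1) hT
      rw [Finset.sum_range_succ]
      omega
  rcases Nat.lt_or_ge t 2 with h1 | h1
  · have : t - 1 = 0 := by omega
    rw [this]
    omega
  · obtain ⟨T, rfl⟩ : ∃ T, t = T + 2 := ⟨t - 2, by omega⟩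
    have h1 := hc T (by omega)
    have h2 := he T (by omega)
    rw [Finset.sum_range_succ]
    omega

lemma sum_block_le (B : IsBlk b t) (m : ℕ × ℕ →₀ ℕ) :
    ∑ i ∈ Finset.range t, (bw b m i (b i) + bw b m i (b (i + 1))) ≤ m.degree := by
  classical
  have h1 : IsCov b t b := fun i hi => ⟨le_rfl, (B.lt i hi).le⟩
  have h2 : IsCov b t (fun i => b (i + 1)) := fun i hi => ⟨(B.lt i hi).le, le_rfl⟩
  have hv : ∀ v, omg b t b v + omg b t (fun i => b (i + 1)) v ≤ 1 := by
    rintro ⟨r, j⟩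
    by_cases hr1 : r = 1
    · subst hr1
      have e1 : omg b t b (1, j) = 0 := by
        by_contra hh
        obtain ⟨i, hi, h3, h4⟩ := (omg1 j).1 hh
        omega
      rw [e1, zero_add]
      by_cases e2 : omg b t (fun i => b (i + 1)) (1, j) = 0
      · omega
      · obtain ⟨i, hi, h3, h4⟩ := (omg1 j).1 e2
        rw [omg_one B h2 hi h3 h4]
        split_ifs <;> omega
    by_cases hr2 : r = 2
    · subst hr2
      have e1 : omg b t (fun i => b (i + 1)) (2, j) = 0 := by
        by_contra hh
        obtain ⟨i, hi, h3, h4⟩ := (omg2 j).1 hh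
        simp only at h3
        omega
      rw [e1, add_zero]
      by_cases e2 : omg b t b (2, j) = 0
      · omega
      · obtain ⟨i, hi, h3, h4⟩ := (omg2 j).1 e2
        rw [omg_two B h1 hi h3 h4]
        split_ifs <;> omega
    · rw [(isDatum B h1).w3 r j hr1 hr2, (isDatum B h2).w3 r j hr1 hr2]
      omega
  rw [Finset.sum_add_distrib, ← weight_omg b t b, ← weight_omg b t (fun i => b (i + 1))]
  induction m using Finsupp.induction_linear with
  | zero => simp
  | add a c ha hc =>
    simp only [map_add]
    omega
  | single v n =>
    simp only [Finsupp.weight_single, Finsupp.degree_single, smul_eq_mul]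
    have := Nat.mul_le_mul_left n (hv v)
    linarith

theorem lower_bound (B : IsBlk b t) (ht : 1 ≤ t) {k d : ℕ} {f : MvPolynomial (ℕ × ℕ) K}
    (hf : f.IsHomogeneous d) {P : Ideal (MvPolynomial (ℕ × ℕ) K)} (hP : P.IsPrime)
    (hPf : ∀ a, a ∈ P ↔ a * f ∈ JB K b t ^ k) :
    ∃ s, 2 * (t - 1) ≤ 3 * s ∧ s + 2 * (k - 1) ≤ d := by
  classical
  have hfn : f ∉ JB K b t ^ k := by
    intro h
    exact hP.ne_top ((Ideal.eq_top_iff_one _).2 ((hPf 1).2 (by simpa using h)))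
  obtain ⟨f', m, h1, hm, ⟨g0, hg0, hg0k⟩, hhom⟩ := red B hfn
  have hdeg : m.degree = d := by
    have := hhom d hf (mem_support_iff.1 hm.1)
    rwa [Finsupp.degree_eq_weight_one]
  have hJP : JB K b t ≤ P := by
    have hpow : JB K b t ^ k ≤ P := fun a ha => (hPf a).2 (Ideal.mul_mem_right _ _ ha)
    exact hP.le_of_pow_le hpow
  have key : ∀ a e, a ∈ P → LeadMono wtZ a e → ∀ T, IsCov b t T →
      k ≤ Finsupp.weight (omg b t T) e + Finsupp.weight (omg b t T) m := by
    intro a e ha hL T hT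
    have h2 : a * f' ∈ JB K b t ^ k := by
      have e1 : a * f' = a * f - a * (f - f') := by ring
      rw [e1]
      exact Ideal.sub_mem _ ((hPf a).1 ha) (Ideal.mul_mem_left _ _ h1)
    have := lead_JB B hT h2 (top_mul hL hm)
    rwa [map_add] at this
  -- minimising cover
  have hmin : ∀ i, ∃ γ, i < t → b i ≤ γ ∧ γ ≤ b (i + 1) ∧
      ∀ γ', b i ≤ γ' → γ' ≤ b (i + 1) → bw b m i γ ≤ bw b m i γ' := by
    intro i
    by_cases hi : i < t
    · obtain ⟨γ, hγ, h⟩ := Finset.exists_min_image (Finset.Icc (b i) (b (i + 1))) (bw b m i)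
        ⟨b i, Finset.mem_Icc.2 ⟨le_rfl, (B.lt i hi).le⟩⟩
      rw [Finset.mem_Icc] at hγ
      exact ⟨γ, fun _ => ⟨hγ.1, hγ.2, fun γ' h1 h2 => h γ' (Finset.mem_Icc.2 ⟨h1, h2⟩)⟩⟩
    · exact ⟨0, fun h => absurd h hi⟩
  choose g hg' using hmin
  have hg : IsCov b t g := fun i hi => ⟨(hg' i hi).1, (hg' i hi).2.1⟩
  have hgm : ∀ i, i < t → ∀ γ', b i ≤ γ' → γ' ≤ b (i + 1) → bw b m i (g i) ≤ bw b m i γ' :=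
    fun i hi => (hg' i hi).2.2
  set A := Finsupp.weight (omg b t g) m with hA
  have hAk : A < k := by
    refine lt_of_le_of_lt ?_ hg0k
    rw [hA, weight_omg, weight_omg]
    refine Finset.sum_le_sum fun i hi => ?_
    rw [Finset.mem_range] at hi
    exact hgm i hi _ (hg0 i hi).1 (hg0 i hi).2
  have hedg : ∀ T u v, Finsupp.weight (omg b t T) (edg u v) =
      omg b t T (1, u) + omg b t T (2, v) := by
    intro T u v
    simp [edg, Finsupp.weight_single]
  have hX : ∀ T r s, Finsupp.weight (omg b t T) (Finsupp.single (r, s) 1) = omg b t T (r, s) := by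
    intro T r s
    simp [Finsupp.weight_single]
  have hA1 : k ≤ A + 1 := by
    have hb01 := B.lt 0 (by omega)
    have := hg 0 (by omega)
    rcases Nat.lt_or_ge (b 0) (g 0) with h | h
    · have h2 := key _ _ (hJP (minor_mem_JB (K := K) ⟨h, 0, by omega, le_rfl, this.2⟩))
        (minor_lead h) g hg
      rw [hedg, omg_one B hg (k := 0) (by omega) le_rfl hb01,
        omg_two B hg (k := 0) (by omega) h this.2] at h2
      simp [h] at h2
      omega
    · have h2 := key _ _ (hJP (minor_mem_JB (K := K) ⟨hb01, 0, by omega, le_rfl, le_rfl⟩))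
        (minor_lead hb01) g hg
      rw [hedg, omg_one B hg (k := 0) (by omega) le_rfl hb01,
        omg_two B hg (k := 0) (by omega) hb01 le_rfl] at h2
      have h3 : ¬ b 0 < g 0 := by omega
      have h4 : g 0 < b (0 + 1) := by omega
      simp only [h3, h4, if_true, if_false] at h2
      omega
  -- the local inequalities
  have hcut : ∀ j, j + 1 < t →
      bw b m j (g j) + 1 ≤ bw b m j (b j) ∨
      bw b m (j + 1) (g (j + 1)) + 1 ≤ bw b m (j + 1) (b (j + 1 + 1)) ∨
      (bw b m j (g j) + 1 ≤ bw b m j (b (j + 1)) ∧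
        bw b m (j + 1) (g (j + 1)) + 1 ≤ bw b m (j + 1) (b (j + 1))) := by
    intro j hj
    have hj0 : j < t := by omega
    have c1 := hg j hj0
    have c2 := hg (j + 1) hj
    have l1 := B.lt j hj0
    have l2 := B.lt (j + 1) hj
    set s := b (j + 1) with hs
    have pl1 : ∀ p q : ℕ, (X (1, s) : MvPolynomial (ℕ × ℕ) K) * minor K 1 2 p q =
        X (1, p) * minor K 1 2 s q + X (1, q) * minor K 1 2 p s := by
      intro p q
      simp only [minor]
      ring
    have pl2 : ∀ p q : ℕ, (X (2, s) : MvPolynomial (ℕ × ℕ) K) * minor K 1 2 p q =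
        X (2, p) * minor K 1 2 s q + X (2, q) * minor K 1 2 p s := by
      intro p q
      simp only [minor]
      ring
    have mem : ∀ r p q : ℕ, (r = 1 ∨ r = 2) → b j ≤ p → p < s → s < q → q ≤ b (j + 1 + 1) →
        (X (r, s) : MvPolynomial (ℕ × ℕ) K) * minor K 1 2 p q ∈ P := by
      intro r p q hr h1 h2 h3 h4
      have m1 : minor K 1 2 s q ∈ P := hJP (minor_mem_JB ⟨h3, j + 1, hj, le_rfl, h4⟩)
      have m2 : minor K 1 2 p s ∈ P := hJP (minor_mem_JB ⟨h2, j, hj0, h1, le_rfl⟩)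
      rcases hr with rfl | rfl
      · rw [pl1]
        exact Ideal.add_mem _ (Ideal.mul_mem_left _ _ m1) (Ideal.mul_mem_left _ _ m2)
      · rw [pl2]
        exact Ideal.add_mem _ (Ideal.mul_mem_left _ _ m1) (Ideal.mul_mem_left _ _ m2)
    have ox : omg b t g (1, s) = if s < g (j + 1) then 1 else 0 :=
      omg_one B hg hj le_rfl l2
    have oy : omg b t g (2, s) = if g j < s then 1 else 0 :=
      omg_two B hg hj0 l1 le_rfl
    rcases Nat.lt_or_ge (g j) s with hL | hL
    · rcases Nat.lt_or_ge s (g (j + 1)) with hR | hR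
      · -- state S
        have hD : minor K 1 2 (g j) (g (j + 1)) ∉ P := by
          intro hD
          have h2 := key _ _ hD (minor_lead (by omega)) g hg
          rw [hedg, omg_one B hg hj0 c1.1 hL, omg_two B hg hj hR c2.2] at h2
          simp at h2
          omega
        have hx : (X (1, s) : MvPolynomial (ℕ × ℕ) K) ∈ P :=
          (hP.mem_or_mem (mem 1 _ _ (Or.inl rfl) c1.1 hL hR c2.2)).resolve_right hD
        have hy : (X (2, s) : MvPolynomial (ℕ × ℕ) K) ∈ P :=
          (hP.mem_or_mem (mem 2 _ _ (Or.inr rfl) c1.1 hL hR c2.2)).resolve_right hD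
        right; right
        constructor
        · have hT : IsCov b t (Function.update g j s) := hg.update l1.le le_rfl
          have h2 := key _ _ hy (LeadMono.X _ _) _ hT
          have h3 := weight_update (b := b) g (γ := s) hj0 m
          rw [hX, omg_two B hT hj0 l1 le_rfl] at h2
          simp only [Function.update_self, lt_irrefl, if_false] at h2
          omega
        · have hT : IsCov b t (Function.update g (j + 1) s) := hg.update le_rfl l2.le
          have h2 := key _ _ hx (LeadMono.X _ _) _ hT
          have h3 := weight_update (b := b) g (γ := s) hj m
          rw [hX, omg_one B hT hj le_rfl l2, Function.update_self, if_neg (lt_irrefl _)] at h2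
          omega
      · -- state R
        have hx : (X (1, s) : MvPolynomial (ℕ × ℕ) K) ∉ P := by
          intro hx
          have h2 := key _ _ hx (LeadMono.X _ _) g hg
          rw [hX, ox, if_neg (by omega)] at h2
          omega
        have hD : minor K 1 2 (g j) (b (j + 1 + 1)) ∈ P :=
          (hP.mem_or_mem (mem 1 _ _ (Or.inl rfl) c1.1 hL l2 le_rfl)).resolve_left hx
        right; left
        have hT : IsCov b t (Function.update g (j + 1) (b (j + 1 + 1))) := hg.update l2.le le_rfl
        have h2 := key _ _ hD (minor_lead (by omega)) _ hT
        have h3 := weight_update (b := b) g (γ := b (j + 1 + 1)) hj m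
        rw [hedg, omg_one B hT hj0 c1.1 hL, omg_two B hT hj l2 le_rfl] at h2
        rw [Function.update_of_ne (by omega)] at h2
        simp only [Function.update_self, lt_irrefl, if_false] at h2
        omega
    · have hy : (X (2, s) : MvPolynomial (ℕ × ℕ) K) ∉ P := by
        intro hy
        have h2 := key _ _ hy (LeadMono.X _ _) g hg
        rw [hX, oy, if_neg (by omega)] at h2
        omega
      rcases Nat.lt_or_ge s (g (j + 1)) with hR | hR
      · -- state L
        have hD : minor K 1 2 (b j) (g (j + 1)) ∈ P :=
          (hP.mem_or_mem (mem 2 _ _ (Or.inr rfl) le_rfl l1 hR c2.2)).resolve_left hy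
        left
        have hT : IsCov b t (Function.update g j (b j)) := hg.update le_rfl l1.le
        have h2 := key _ _ hD (minor_lead (by omega)) _ hT
        have h3 := weight_update (b := b) g (γ := b j) hj0 m
        rw [hedg, omg_one B hT hj0 le_rfl l1, omg_two B hT hj hR c2.2] at h2
        rw [Function.update_of_ne (show j + 1 ≠ j by omega)] at h2
        simp only [Function.update_self, lt_irrefl, if_false] at h2
        omega
      · -- state N
        have hD : minor K 1 2 (b j) (b (j + 1 + 1)) ∈ P :=
          (hP.mem_or_mem (mem 2 _ _ (Or.inr rfl) le_rfl l1 l2 le_rfl)).resolve_left hy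
        have hT0 : IsCov b t (Function.update g j (b j)) := hg.update le_rfl l1.le
        have hT : IsCov b t (Function.update (Function.update g j (b j)) (j + 1)
            (b (j + 1 + 1))) := hT0.update l2.le le_rfl
        have h2 := key _ _ hD (minor_lead (by omega)) _ hT
        have h3 := weight_update (b := b) g (γ := b j) hj0 m
        have h4 := weight_update (b := b) (Function.update g j (b j)) (γ := b (j + 1 + 1)) hj m
        rw [hedg, omg_one B hT hj0 le_rfl l1, omg_two B hT hj l2 le_rfl] at h2
        rw [Function.update_of_ne (show j ≠ j + 1 by omega)] at h2
        rw [Function.update_of_ne (show j + 1 ≠ j by omega)] at h4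
        simp only [Function.update_self, lt_irrefl, if_false] at h2
        omega
  refine ⟨∑ i ∈ Finset.range t, ((bw b m i (b i) - bw b m i (g i)) +
    (bw b m i (b (i + 1)) - bw b m i (g i))), ?_, ?_⟩
  · apply charging (fun i => bw b m i (b i) - bw b m i (g i))
      (fun i => bw b m i (b (i + 1)) - bw b m i (g i))
    intro j hj
    have := hcut j hj
    omega
  · have h2 := sum_block_le B m
    have h3 : ∑ i ∈ Finset.range t, (bw b m i (b i) + bw b m i (b (i + 1))) =
        ∑ i ∈ Finset.range t, ((bw b m i (b i) - bw b m i (g i)) +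
          (bw b m i (b (i + 1)) - bw b m i (g i))) + 2 * A := by
      rw [hA, weight_omg, Finset.mul_sum, ← Finset.sum_add_distrib]
      refine Finset.sum_congr rfl fun i hi => ?_
      rw [Finset.mem_range] at hi
      have e1 := hgm i hi (b i) le_rfl (B.lt i hi).le
      have e2 := hgm i hi (b (i + 1)) (B.lt i hi).le le_rfl
      omega
    omega

end Lower

section Upper
set_option linter.unusedSimpArgs false
set_option linter.unusedVariables false

variable {K : Type*} [Field K] {b g : ℕ → ℕ} {t : ℕ}

lemma IsBlk.strict (B : IsBlk b t) {i j : ℕ} (hij : i < j) (hj : j ≤ t) : b i < b j :=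
  (B.lt i (by omega)).trans_le (B.mono (show i + 1 ≤ j by omega) hj)

lemma IsBlk.inj (B : IsBlk b t) {i j : ℕ} (hi : i ≤ t) (hj : j ≤ t) (h : b i = b j) : i = j := by
  rcases lt_trichotomy i j with h1 | h1 | h1
  · have := B.strict h1 hj
    omega
  · exact h1
  · have := B.strict h1 hi
    omega

lemma setS_cut (B : IsBlk b t) (hg : IsCov b t g) {s : ℕ} (hs : s ∈ setS b t g) :
    ∃ j, 1 ≤ j ∧ j < t ∧ s = b j := by
  obtain ⟨⟨l, hl, h1, h2⟩, ⟨l', hl', h3, h4⟩⟩ := hs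
  rcases lt_trichotomy l' l with h | h | h
  · have := B.mono (show l' + 1 ≤ l by omega) hl.le
    exact ⟨l, by omega, hl, by omega⟩
  · subst h
    omega
  · have := B.mono (show l + 1 ≤ l' by omega) hl'.le
    have := (hg l hl).2
    have := (hg l' hl').1
    omega

open Classical in
noncomputable def rep (S : Set ℕ) (n : ℕ) : ℕ → ℕ
  | 0 => 0
  | i + 1 => if i ∈ S ∨ i = 0 ∨ n ≤ i then i + 1 else rep S n i

lemma rep_le (S : Set ℕ) (n i : ℕ) : rep S n i ≤ i := by
  induction i with
  | zero => simp [rep]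
  | succ i ih =>
    rw [rep]
    split_ifs <;> omega

lemma lt_rep {S : Set ℕ} {n s : ℕ} (hs : s ∈ S) (w : ℕ) (h : s < w) : s < rep S n w := by
  induction w with
  | zero => omega
  | succ w ih =>
    rw [rep]
    split_ifs with hc
    · exact h
    · push Not at hc
      refine ih (lt_of_le_of_ne (by omega) ?_)
      rintro rfl
      exact hc.1 hs

/-- the chosen cut set -/
def cutS (b : ℕ → ℕ) (q : ℕ) : Set ℕ := {s | ∃ i, i < q ∧ s = b (3 * i + 2)}

lemma rep_eq (B : IsBlk b t) {q : ℕ} (hq : 3 * q < t) {u v i : ℕ} (hi : i < t) (huv : u ≤ v)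
    (h1 : b i ≤ u) (h2 : v ≤ b (i + 1)) (hu : u ∉ cutS b q) :
    rep (cutS b q) (b t) u = rep (cutS b q) (b t) v := by
  induction v, huv using Nat.le_induction with
  | base => rfl
  | succ v hv ih =>
    rw [ih (by omega), rep, if_neg]
    have := B.mono (show i + 1 ≤ t by omega) le_rfl
    have := B.one_le hi.le
    push Not
    refine ⟨?_, by omega, by omega⟩
    rintro ⟨l, hl, rfl⟩
    have : 3 * l + 2 = i := by
      rcases lt_trichotomy (3 * l + 2) i with h | h | h
      · have := B.strict h hi.le
        omega
      · exact h
      · have := B.mono (show i + 1 ≤ 3 * l + 2 by omega) (by omega)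
        omega
    rw [this] at hv
    apply hu
    refine ⟨l, hl, ?_⟩
    rw [this]
    omega

open Classical in
noncomputable def psi (K : Type*) [Field K] (S : Set ℕ) (n : ℕ) (v : ℕ × ℕ) :
    MvPolynomial ((ℕ × ℕ) ⊕ ℕ) K :=
  if v.1 = 1 ∨ v.1 = 2 then
    (if v.2 ∈ S then 0 else X (Sum.inl (v.1, rep S n v.2)) * X (Sum.inr v.2))
  else X (Sum.inl v)

/-- the product polynomial -/
noncomputable def polF (K : Type*) [Field K] (b : ℕ → ℕ) (t q : ℕ) : MvPolynomial (ℕ × ℕ) K :=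
  (∏ i ∈ Finset.range q, minor K 1 2 (b (3 * i + 1)) (b (3 * i + 3))) *
    ∏ j ∈ Finset.Ioc (3 * q) (t - 1), X (1, b j)

lemma polF_homog (q : ℕ) : (polF K b t q).IsHomogeneous (2 * q + (t - 1 - 3 * q)) := by
  unfold polF
  have h1 := IsHomogeneous.prod (Finset.range q)
    (fun i => minor K 1 2 (b (3 * i + 1)) (b (3 * i + 3))) (fun _ => 2)
    (fun i _ => minor_homog _ _ _ _)
  have h2 := IsHomogeneous.prod (Finset.Ioc (3 * q) (t - 1))
    (fun j => (X (1, b j) : MvPolynomial (ℕ × ℕ) K)) (fun _ => 1)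
    (fun i _ => isHomogeneous_X K _)
  have := h1.mul h2
  convert this using 1
  simp
  ring

lemma cen_rep (B : IsBlk b t) (hg : IsCov b t g) (i : ℕ) (hi : i ∉ setS b t g) :
    rep (setS b t g) (b t) i ∉ setS b t g ∧
      cen b t g (rep (setS b t g) (b t) i) = cen b t g i := by
  induction i with
  | zero => exact ⟨by simpa [rep] using hi, by simp [rep]⟩
  | succ i ih =>
    rw [rep]
    split_ifs with hc
    · exact ⟨hi, rfl⟩
    · push Not at hc
      obtain ⟨h1, h2⟩ := ih hc.1
      refine ⟨h1, h2.trans ?_⟩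
      have hex : ∃ l, l < t ∧ b l ≤ i ∧ i + 1 ≤ b (l + 1) := by
        have hlt : i < b t := hc.2.2
        have hge : b 0 ≤ i := by rw [B.h0]; omega
        by_contra hno
        push Not at hno
        have : ∀ l, l ≤ t → b l ≤ i := by
          intro l
          induction l with
          | zero => intro _; exact hge
          | succ l ihl =>
            intro hl
            have := hno l (by omega) (ihl (by omega))
            omega
        have := this t le_rfl
        omega
      obtain ⟨l, hl, h3, h4⟩ := hex
      exact cen_eq B hg hl (Nat.lt_succ_self i) h3 h4 hc.1 hi

lemma ker_mul_polF (B : IsBlk b t) {q : ℕ} (hq : 3 * q < t) {p : MvPolynomial (ℕ × ℕ) K}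
    (hp : aeval (psi K (cutS b q) (b t)) p = 0) : p * polF K b t q ∈ JB K b t := by
  classical
  refine mem_JB_of_kill B fun g hg => ?_
  rw [map_mul, map_mul]
  have D := isDatum B hg
  by_cases hS : setS b t g = cutS b q
  · -- factor through psi
    have hcomp : ∀ p : MvPolynomial (ℕ × ℕ) K,
        aeval (killVar (K := K) (omg b t g)) (aeval (phi K (setS b t g) (cen b t g)) p) =
        aeval (fun w : (ℕ × ℕ) ⊕ ℕ => Sum.elim
          (fun v : ℕ × ℕ => if v.1 = 1 ∨ v.1 = 2 then
            (X (v.1, cen b t g v.2) : MvPolynomial (ℕ × ℕ) K) else X v)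
          (fun i => pfac K (cen b t g) i) w) (aeval (psi K (cutS b q) (b t)) p) := by
      intro p
      have : ((aeval (killVar (K := K) (omg b t g))).comp
          (aeval (phi K (setS b t g) (cen b t g)))) =
          (aeval (fun w : (ℕ × ℕ) ⊕ ℕ => Sum.elim
          (fun v : ℕ × ℕ => if v.1 = 1 ∨ v.1 = 2 then
            (X (v.1, cen b t g v.2) : MvPolynomial (ℕ × ℕ) K) else X v)
          (fun i => pfac K (cen b t g) i) w)).comp (aeval (psi K (cutS b q) (b t))) := by
        apply MvPolynomial.algHom_ext
        rintro ⟨r, i⟩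
        simp only [AlgHom.comp_apply, aeval_X]
        by_cases hr : r = 1 ∨ r = 2
        · by_cases hi : i ∈ setS b t g
          · rw [D.kill_S hr hi]
            have hi' : i ∈ cutS b q := hS ▸ hi
            simp only [psi, hr, hi', if_true, map_zero]
          · rw [D.kill_row hr hi]
            have hi' : i ∉ cutS b q := hS ▸ hi
            have hc := (cen_rep B hg i hi).2
            rw [hS] at hc
            simp only [psi, hr, hi', if_true, if_false, map_mul, aeval_X, Sum.elim_inl,
              Sum.elim_inr, hc]
        · have h1 : r ≠ 1 := fun h => hr (Or.inl h)
          have h2 : r ≠ 2 := fun h => hr (Or.inr h)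
          rw [D.kill_other h1 h2]
          simp only [psi, hr, if_false, aeval_X, Sum.elim_inl]
      exact DFunLike.congr_fun this p
    rw [hcomp p, hp, map_zero, zero_mul]
  · -- the polynomial polF is killed
    have hF : aeval (killVar (K := K) (omg b t g))
        (aeval (phi K (setS b t g) (cen b t g)) (polF K b t q)) = 0 := by
      have hcase : (∃ i, i < q ∧ ((b (3 * i + 1) ∈ setS b t g ∨ b (3 * i + 3) ∈ setS b t g) ∨
          b (3 * i + 2) ∉ setS b t g)) ∨ ∃ j, 3 * q < j ∧ j < t ∧ b j ∈ setS b t g := by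
        by_contra hno
        push Not at hno
        apply hS
        ext s
        constructor
        · intro hs
          obtain ⟨j, hj1, hjt, rfl⟩ := setS_cut B hg hs
          have hjq : j ≤ 3 * q := by
            by_contra hh
            exact hno.2 j (by omega) hjt hs
          have hx := hno.1 ((j - 1) / 3) (by omega)
          have h3 : j = 3 * ((j - 1) / 3) + 1 ∨ j = 3 * ((j - 1) / 3) + 2 ∨
              j = 3 * ((j - 1) / 3) + 3 := by omega
          rcases h3 with h3 | h3 | h3
          · rw [h3] at hs
            exact absurd hs hx.1.1
          · exact ⟨(j - 1) / 3, by omega, by rw [← h3]⟩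
          · rw [h3] at hs
            exact absurd hs hx.1.2
        · rintro ⟨i, hi, rfl⟩
          exact (hno.1 i hi).2
      rw [polF, map_mul, map_mul]
      rcases hcase with ⟨i, hi, h⟩ | ⟨j, hj, hjt, h⟩
      · rw [map_prod, map_prod, Finset.prod_eq_zero (Finset.mem_range.2 hi), zero_mul]
        refine kill_minor_same B hg fun hu hv => ?_
        have hm : b (3 * i + 2) ∉ setS b t g := by
          rcases h with (h | h) | h
          · exact absurd h hu
          · exact absurd h hv
          · exact h
        have e1 := cen_eq B hg (k := 3 * i + 1) (by omega) (B.lt (3 * i + 1) (by omega)) le_rfl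
          le_rfl hu hm
        have e2 := cen_eq B hg (k := 3 * i + 2) (by omega) (B.lt (3 * i + 2) (by omega)) le_rfl
          le_rfl hm hv
        exact e1.trans e2
      · refine mul_eq_zero_of_right _ ?_
        rw [map_prod, map_prod]
        refine Finset.prod_eq_zero (i := j) (Finset.mem_Ioc.2 ⟨hj, by omega⟩) ?_
        rw [aeval_X]
        exact D.kill_S (Or.inl rfl) h
    rw [hF, mul_zero]

lemma psi_minor (S : Set ℕ) (n u v : ℕ) (hu : u ∉ S) (hv : v ∉ S) :
    aeval (psi K S n) (minor K 1 2 u v) =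
      (X (Sum.inl (1, rep S n u)) * X (Sum.inl (2, rep S n v)) -
        X (Sum.inl (1, rep S n v)) * X (Sum.inl (2, rep S n u))) *
        (X (Sum.inr u) * X (Sum.inr v)) := by
  simp only [minor, map_sub, map_mul, aeval_X, psi, hu, hv, true_or, or_true, if_true, if_false]
  ring

lemma psi_edge (B : IsBlk b t) {q : ℕ} (hq : 3 * q < t) {u v : ℕ} (h : bAdj b t u v) :
    aeval (psi K (cutS b q) (b t)) (minor K 1 2 u v) = 0 := by
  obtain ⟨huv, i, hi, h1, h2⟩ := h
  by_cases hu : u ∈ cutS b q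
  · simp [minor, psi, hu]
  by_cases hv : v ∈ cutS b q
  · simp [minor, psi, hv]
  rw [psi_minor _ _ _ _ hu hv, rep_eq B hq hi huv.le h1 h2 hu, sub_self, zero_mul]

lemma notMem_cutS (B : IsBlk b t) {q : ℕ} (hq : 3 * q < t) {j : ℕ} (hj : j ≤ t)
    (h : ∀ i, i < q → j ≠ 3 * i + 2) : b j ∉ cutS b q := by
  rintro ⟨i, hi, hE⟩
  exact h i hi (B.inj hj (by omega) hE)

lemma psi_polF (B : IsBlk b t) {q : ℕ} (hq : 3 * q < t) :
    aeval (psi K (cutS b q) (b t)) (polF K b t q) ≠ 0 := by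
  classical
  rw [polF, map_mul]
  refine mul_ne_zero ?_ ?_
  · rw [map_prod, Finset.prod_ne_zero_iff]
    intro i hi
    rw [Finset.mem_range] at hi
    rw [psi_minor _ _ _ _ (notMem_cutS B hq (by omega) (by omega))
      (notMem_cutS B hq (by omega) (by omega))]
    refine mul_ne_zero ?_ (mul_ne_zero (X_ne_zero _) (X_ne_zero _))
    have h1 := rep_le (cutS b q) (b t) (b (3 * i + 1))
    have h2 := B.lt (3 * i + 1) (by omega)
    have h3 : b (3 * i + 2) < rep (cutS b q) (b t) (b (3 * i + 3)) :=
      lt_rep (show b (3 * i + 2) ∈ cutS b q from ⟨i, hi, rfl⟩) _ (B.lt (3 * i + 2) (by omega))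
    intro h0
    have := congrArg (aeval (fun w : (ℕ × ℕ) ⊕ ℕ =>
      if w = Sum.inl (1, rep (cutS b q) (b t) (b (3 * i + 1))) ∨
        w = Sum.inl (2, rep (cutS b q) (b t) (b (3 * i + 3))) then (1 : K) else 0)) h0
    simp only [map_sub, map_mul, aeval_X, map_zero] at this
    have hne : rep (cutS b q) (b t) (b (3 * i + 3)) ≠ rep (cutS b q) (b t) (b (3 * i + 1)) := by
      have e : 3 * i + 1 + 1 = 3 * i + 2 := rfl
      rw [e] at h2
      omega
    simp [hne] at this
  · rw [map_prod, Finset.prod_ne_zero_iff]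
    intro j hj
    rw [Finset.mem_Ioc] at hj
    have := notMem_cutS B hq (j := j) (by omega) (by omega)
    simp only [aeval_X, psi, this, true_or, if_true, if_false]
    exact mul_ne_zero (X_ne_zero _) (X_ne_zero _)

open Classical in
noncomputable def psiE (K : Type*) [Field K] (S : Set ℕ) (n : ℕ) (v : ℕ × ℕ) :
    Polynomial (MvPolynomial ((ℕ × ℕ) ⊕ ℕ) K) :=
  Polynomial.C (psi K S n v) + if v = (1, 1) then Polynomial.X else 0

lemma psiE_eval (S : Set ℕ) (n : ℕ) (p : MvPolynomial (ℕ × ℕ) K) :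
    (aeval (psiE K S n) p).eval 0 = aeval (psi K S n) p := by
  classical
  induction p using MvPolynomial.induction_on with
  | C a =>
    simp only [algHom_C]
    rw [IsScalarTower.algebraMap_apply K (MvPolynomial ((ℕ × ℕ) ⊕ ℕ) K)
      (Polynomial (MvPolynomial ((ℕ × ℕ) ⊕ ℕ) K))]
    simp
  | add p q hp hq => simp [hp, hq]
  | mul_X p v hp =>
    simp only [map_mul, aeval_X, Polynomial.eval_mul, hp, psiE]
    congr 1
    split_ifs <;> simp

lemma psi_of_mem (B : IsBlk b t) (ht : 1 ≤ t) {q k : ℕ} (hq : 3 * q < t)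
    {a : MvPolynomial (ℕ × ℕ) K}
    (h : a * (polF K b t q * minor K 1 2 1 2 ^ k) ∈ JB K b t ^ (k + 1)) :
    aeval (psi K (cutS b q) (b t)) a = 0 := by
  classical
  have hJ : JB K b t ≤ Ideal.comap (aeval (psiE K (cutS b q) (b t)))
      (Ideal.span {(Polynomial.X : Polynomial (MvPolynomial ((ℕ × ℕ) ⊕ ℕ) K))}) := by
    refine Ideal.span_le.2 ?_
    rintro f ⟨u, v, huv, rfl⟩
    rw [SetLike.mem_coe, Ideal.mem_comap, Ideal.mem_span_singleton, Polynomial.X_dvd_iff, Polynomial.coeff_zero_eq_eval_zero,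
      psiE_eval, psi_edge B hq huv]
  have h2 : aeval (psiE K (cutS b q) (b t)) (a * (polF K b t q * minor K 1 2 1 2 ^ k)) ∈
      Ideal.span {(Polynomial.X : Polynomial (MvPolynomial ((ℕ × ℕ) ⊕ ℕ) K))} ^ (k + 1) := by
    have := Ideal.pow_right_mono hJ (k + 1) h
    exact Ideal.le_comap_pow _ _ this
  rw [Ideal.span_singleton_pow, Ideal.mem_span_singleton] at h2
  have hb0 := B.h0
  have hb1 := B.lt 0 (by omega)
  rw [hb0] at hb1
  have h12 : bAdj b t 1 2 := ⟨by omega, 0, by omega, by omega, hb1⟩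
  have h2S : (2 : ℕ) ∉ cutS b q := by
    rintro ⟨i, hi, hE⟩
    have := B.strict (show 1 < 3 * i + 2 by omega) (by omega)
    simp at hb1
    omega
  have hh : aeval (psiE K (cutS b q) (b t)) (minor K 1 2 1 2) =
      Polynomial.X * Polynomial.C (psi K (cutS b q) (b t) (2, 2)) := by
    have h3 := psi_edge (K := K) B hq h12
    simp only [minor, map_sub, map_mul, aeval_X] at h3
    have h4 := congrArg (Polynomial.C) h3
    simp only [Polynomial.C_sub, Polynomial.C_mul, Polynomial.C_0] at h4
    simp only [minor, map_sub, map_mul, aeval_X, psiE]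
    simp only [if_true, Prod.mk.injEq, true_and, and_true, show ¬ ((2 : ℕ) = 1) by omega,
      false_and, and_false, if_false, add_zero]
    linear_combination h4
  rw [map_mul, map_mul, map_pow, hh, mul_pow, pow_succ] at h2
  have h5 : (Polynomial.X : Polynomial (MvPolynomial ((ℕ × ℕ) ⊕ ℕ) K)) ∣
      aeval (psiE K (cutS b q) (b t)) a * (aeval (psiE K (cutS b q) (b t)) (polF K b t q) *
        Polynomial.C (psi K (cutS b q) (b t) (2, 2)) ^ k) := by
    refine (mul_dvd_mul_iff_left (pow_ne_zero k Polynomial.X_ne_zero)).1 ?_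
    convert h2 using 1
    ring
  rw [Polynomial.X_dvd_iff, Polynomial.coeff_zero_eq_eval_zero] at h5
  simp only [Polynomial.eval_mul, Polynomial.eval_pow, Polynomial.eval_C, psiE_eval] at h5
  have h6 : psi K (cutS b q) (b t) (2, 2) ≠ 0 := by
    simp only [psi, h2S, or_true, if_true, if_false]
    exact mul_ne_zero (X_ne_zero _) (X_ne_zero _)
  exact (mul_eq_zero.1 h5).resolve_right (mul_ne_zero (psi_polF B hq) (pow_ne_zero k h6))

theorem mem_iff_psi (B : IsBlk b t) (ht : 1 ≤ t) {q k : ℕ} (hq : 3 * q < t)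
    (a : MvPolynomial (ℕ × ℕ) K) :
    a * (polF K b t q * minor K 1 2 1 2 ^ k) ∈ JB K b t ^ (k + 1) ↔
      a ∈ RingHom.ker (aeval (psi K (cutS b q) (b t)) : MvPolynomial (ℕ × ℕ) K →ₐ[K] _) := by
  rw [RingHom.mem_ker]
  refine ⟨psi_of_mem B ht hq, fun h => ?_⟩
  have h1 := ker_mul_polF B hq h
  have hb0 := B.h0
  have hb1 := B.lt 0 (by omega)
  rw [hb0] at hb1
  have h12 : bAdj b t 1 2 := ⟨by omega, 0, by omega, by omega, hb1⟩
  have h2 := Ideal.pow_mem_pow (minor_mem_JB (K := K) h12) k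
  rw [pow_succ', ← mul_assoc]
  exact Ideal.mul_mem_mul h1 h2

end Upper

section Final

variable {K : Type*} [Field K] {b : ℕ → ℕ} {t : ℕ}

lemma mem_colon' {R : Type*} [CommRing R] (I : Ideal R) (f a : R) :
    a ∈ Submodule.colon I (Ideal.span {f} : Ideal R) ↔ a * f ∈ I := by
  rw [Ideal.mem_colon_span_singleton]

theorem vNumber_JB (B : IsBlk b t) (ht : 1 ≤ t) {k : ℕ} (hk : 1 ≤ k) :
    vNumber (JB K b t ^ k) = (2 * (t - 1)) ⌈/⌉ 3 + 2 * (k - 1) := by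
  obtain ⟨k, rfl⟩ : ∃ l, k = l + 1 := ⟨k - 1, by omega⟩
  have hceil : (2 * (t - 1)) ⌈/⌉ 3 = 2 * ((t - 1) / 3) + (t - 1 - 3 * ((t - 1) / 3)) := by
    rw [Nat.ceilDiv_eq_add_pred_div]
    omega
  have hq : 3 * ((t - 1) / 3) < t := by omega
  unfold vNumber
  have hmem : (2 * (t - 1)) ⌈/⌉ 3 + 2 * (k + 1 - 1) ∈ {d : ℕ | ∃ f : MvPolynomial (ℕ × ℕ) K,
    f.IsHomogeneous d ∧ (Submodule.colon (JB K b t ^ (k + 1)) (Ideal.span {f})).IsPrime ∧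
    Submodule.colon (JB K b t ^ (k + 1)) (Ideal.span {f}) ∈
      associatedPrimes (MvPolynomial (ℕ × ℕ) K)
      (MvPolynomial (ℕ × ℕ) K ⧸ (JB K b t ^ (k + 1)))} := by
    have hcol : Submodule.colon (JB K b t ^ (k + 1)) (Ideal.span
        {polF K b t ((t - 1) / 3) * minor K 1 2 1 2 ^ k} : Ideal (MvPolynomial (ℕ × ℕ) K)) =
        RingHom.ker (aeval (psi K (cutS b ((t - 1) / 3)) (b t)) :
          MvPolynomial (ℕ × ℕ) K →ₐ[K] _) := by
      ext a
      rw [mem_colon', mem_iff_psi B ht hq]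
    have hprime : (RingHom.ker (aeval (psi K (cutS b ((t - 1) / 3)) (b t)) :
          MvPolynomial (ℕ × ℕ) K →ₐ[K] _)).IsPrime := RingHom.ker_isPrime _
    refine ⟨polF K b t ((t - 1) / 3) * minor K 1 2 1 2 ^ k, ?_, ?_, ?_⟩
    · rw [hceil]
      have := (polF_homog (K := K) (b := b) (t := t) ((t - 1) / 3)).mul
        ((minor_homog (K := K) 1 2 1 2).pow k)
      exact this
    · rw [hcol]
      exact hprime
    · rw [hcol]
      refine ⟨hprime, Ideal.Quotient.mk _ (polF K b t ((t - 1) / 3) * minor K 1 2 1 2 ^ k), ?_⟩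
      have : (Submodule.colon (⊥ : Submodule (MvPolynomial (ℕ × ℕ) K)
          (MvPolynomial (ℕ × ℕ) K ⧸ JB K b t ^ (k + 1)))
          {Ideal.Quotient.mk _ (polF K b t ((t - 1) / 3) * minor K 1 2 1 2 ^ k)}) =
          RingHom.ker (aeval (psi K (cutS b ((t - 1) / 3)) (b t)) :
          MvPolynomial (ℕ × ℕ) K →ₐ[K] _) := by
        ext a
        rw [← mem_iff_psi B ht hq, Submodule.mem_colon_singleton, Submodule.mem_bot,
          ← Ideal.Quotient.eq_zero_iff_mem, map_mul]
        rfl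
      rw [this, hprime.radical]
  apply le_antisymm
  · exact Nat.sInf_le hmem
  · apply le_csInf
    · exact ⟨_, hmem⟩
    · rintro d ⟨f, hf, hP, -⟩
      obtain ⟨s, h1, h2⟩ := lower_bound B ht hf hP (fun a => mem_colon' _ f a)
      have : (2 * (t - 1)) ⌈/⌉ 3 ≤ s := by
        rw [Nat.ceilDiv_eq_add_pred_div]
        omega
      omega

end Final

section Assemble

variable {K : Type*} [Field K] {b : ℕ → ℕ} {t : ℕ}

lemma genBEI_eq_JB {G : SimpleGraph ℕ} (hG : ∀ u v, u < v → (G.Adj u v ↔ bAdj b t u v)) :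
    genBEI K 2 G = JB K b t := by
  unfold genBEI JB
  congr 1
  ext f
  constructor
  · rintro ⟨i, j, u, v, h1, h2, h3, huv, hA, rfl⟩
    obtain rfl : i = 1 := by omega
    obtain rfl : j = 2 := by omega
    exact ⟨u, v, (hG u v huv).1 hA, rfl⟩
  · rintro ⟨u, v, h, rfl⟩
    exact ⟨1, 2, u, v, le_rfl, by omega, le_rfl, h.1, (hG u v h.1).2 h, rfl⟩

end Assemble

/-- Theorem 6.6: for a connected Cohen–Macaulay closed graph `G` with `t ≥ 2` maximal
cliques (the consecutive intervals `[b (i-1), b i]`), the v-number satisfies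
`v(J_{K_2,G}^k) = ⌈2(t−1)/3⌉ + 2(k−1)` for all `k ≥ 1`; in particular for the path
`P_n` (`n ≥ 3`), `v(J_{K_2,P_n}^k) = ⌈2(n−2)/3⌉ + 2(k−1)`. -/
theorem vNumber_pow_CM_closed
    (K : Type*) [Field K] (n t : ℕ) (ht : 2 ≤ t) (G : SimpleGraph ℕ)
    (b : ℕ → ℕ) (hb0 : b 0 = 1) (hbt : b t = n)
    (hbmono : StrictMonoOn b (Set.Icc 0 t))
    (hadj : ∀ u v : ℕ, G.Adj u v ↔
      u ≠ v ∧ ∃ i ∈ Set.Icc 1 t,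
        u ∈ Set.Icc (b (i - 1)) (b i) ∧ v ∈ Set.Icc (b (i - 1)) (b i)) :
    (∀ k : ℕ, 1 ≤ k →
      vNumber ((genBEI K 2 G) ^ k) = (2 * (t - 1)) ⌈/⌉ 3 + 2 * (k - 1)) ∧
    (∀ n' k : ℕ, 3 ≤ n' → 1 ≤ k →
      vNumber ((genBEI K 2 (pathGraph n')) ^ k) = (2 * (n' - 2)) ⌈/⌉ 3 + 2 * (k - 1)) := by
  constructor
  · intro k hk
    have B : IsBlk b t := ⟨hb0, fun i hi =>
      hbmono ⟨Nat.zero_le _, hi.le⟩ ⟨Nat.zero_le _, hi⟩ (Nat.lt_succ_self i)⟩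
    rw [genBEI_eq_JB (b := b) (t := t), vNumber_JB B (by omega) hk]
    intro u v huv
    rw [hadj]
    constructor
    · rintro ⟨-, i, hi, hu, hv⟩
      obtain ⟨i, rfl⟩ : ∃ l, i = l + 1 := ⟨i - 1, by have := hi.1; omega⟩
      exact ⟨huv, i, by have := hi.2; omega, hu.1, hv.2⟩
    · rintro ⟨-, i, hi, h1, h2⟩
      refine ⟨huv.ne, i + 1, ⟨by omega, by omega⟩, ?_⟩
      rw [Nat.add_sub_cancel]
      exact ⟨⟨h1, by omega⟩, ⟨by omega, h2⟩⟩
  · intro n' k hn hk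
    have B : IsBlk (fun i => i + 1) (n' - 1) := ⟨rfl, fun i _ => by simp⟩
    rw [genBEI_eq_JB (b := fun i => i + 1) (t := n' - 1), vNumber_JB B (by omega) hk,
      show n' - 1 - 1 = n' - 2 by omega]
    intro u v huv
    rw [pathGraph, SimpleGraph.fromRel_adj]
    constructor
    · rintro ⟨-, h | h⟩
      · exact ⟨huv, u - 1, by omega, by simp only; omega, by simp only; omega⟩
      · omega
    · rintro ⟨-, i, hi, h1, h2⟩
      simp only at h1 h2
      exact ⟨huv.ne, Or.inl ⟨by omega, by omega, by omega⟩⟩
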